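/- (Lemma 4.7, linear independence of images of chain-free monomials.) Fix k_1, k_2, k_3, k_4 ∈ ℕ, a multiset ℐ_1 of elements of [1,n_1] of cardinality k_1+k_3+2k_4, and a multiset ℐ_3 of elements of [n_1+1,n] of cardinality k_2+k_3. Let G be the set of all formal products f (as in the context) with exactly k_1 x-factors, k_2 y-factors, k_3 z-factors and k_4 ω-factors, satisfying ℐ_1(f) = ℐ_1 and ℐ_3(f) = ℐ_3, such that ℐ(f) contains no 3-chain, no ω-2-chain and no ω-3-chain. Then the family {φ̃(f) : f ∈ G} is linearly independent in A = F[x_1,…,x_n,y_1,…,y_n]. -/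

import Mathlib

open MvPolynomial

/-- A formal product: a multiset of `x`-indices, a multiset of `y`-indices, a multiset of
`z`-index pairs `(j,i)`, and a multiset of `ω`-index pairs `(q,p)` (all indices 1-based). -/
def FormalProd : Type := Multiset ℕ × Multiset ℕ × Multiset (ℕ × ℕ) × Multiset (ℕ × ℕ)

/-- The polynomial `φ̃(f)` in `A = F[x_i, y_i]` (with variable `Sum.inl i` standing for
`x_i` and `Sum.inr i` for `y_i`), where `φ̃(x_a) = x_a`, `φ̃(y_b) = y_b`,
`φ̃(z_{j,i}) = x_i x_j - y_i y_j` and `φ̃(ω_{q,p}) = x_q y_p - x_p y_q`. -/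
noncomputable def phiTilde (F : Type*) [Field F] (f : FormalProd) :
    MvPolynomial (ℕ ⊕ ℕ) F :=
  (f.1.map (fun a => (X (Sum.inl a) : MvPolynomial (ℕ ⊕ ℕ) F))).prod *
  (f.2.1.map (fun b => (X (Sum.inr b) : MvPolynomial (ℕ ⊕ ℕ) F))).prod *
  (f.2.2.1.map (fun z =>
    (X (Sum.inl z.2) * X (Sum.inl z.1) - X (Sum.inr z.2) * X (Sum.inr z.1)
      : MvPolynomial (ℕ ⊕ ℕ) F))).prod *
  (f.2.2.2.map (fun w =>
    (X (Sum.inl w.1) * X (Sum.inr w.2) - X (Sum.inl w.2) * X (Sum.inr w.1)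
      : MvPolynomial (ℕ ⊕ ℕ) F))).prod

/-- The index multiset `ℐ(f) ⊆ ℕ²`: one pair `(n+1, a)` for each `x`-factor, `(b, 0)` for
each `y`-factor, `(j, i)` for each `z`-factor, and `(n+n₁+2-q, p)` for each `ω`-factor. -/
def idxI (n n₁ : ℕ) (f : FormalProd) : Multiset (ℕ × ℕ) :=
  f.1.map (fun a => (n + 1, a)) + f.2.1.map (fun b => (b, 0)) + f.2.2.1 +
    f.2.2.2.map (fun w => (n + n₁ + 2 - w.1, w.2))

/-- `ℐ₁(f)`: the multiset of all `x`-indices, the `i` of each `z`-factor, and both `p`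
and `q` of each `ω`-factor. -/
def idx1 (f : FormalProd) : Multiset ℕ :=
  f.1 + f.2.2.1.map Prod.snd + f.2.2.2.map Prod.fst + f.2.2.2.map Prod.snd

/-- `ℐ₃(f)`: the multiset of all `y`-indices and the `j` of each `z`-factor. -/
def idx3 (f : FormalProd) : Multiset ℕ :=
  f.2.1 + f.2.2.1.map Prod.fst

/-- `S` contains a 3-chain: three elements (at distinct positions) with both coordinates
strictly increasing. -/
def Has3Chain (S : Multiset (ℕ × ℕ)) : Prop :=
  ∃ a ∈ S, ∃ b ∈ S, ∃ c ∈ S, a.1 < b.1 ∧ b.1 < c.1 ∧ a.2 < b.2 ∧ b.2 < c.2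

/-- `S` contains an ω-2-chain: two elements `(j,i)`, `(j',i')` with `j < j'`, `i < i'`
and `j' > n+1`. -/
def HasOmega2Chain (n : ℕ) (S : Multiset (ℕ × ℕ)) : Prop :=
  ∃ a ∈ S, ∃ b ∈ S, a.1 < b.1 ∧ a.2 < b.2 ∧ n + 1 < b.1

/-- `S` contains an ω-3-chain: three elements `(j₁,i₁)`, `(j₂,i₂)`, `(j₃,i₃)` with
`i₃ ≤ i₁ < i₂` and `j₁ < j₂ ≤ n+1 < j₃ < n+n₁+2-i₂`. -/
def HasOmega3Chain (n n₁ : ℕ) (S : Multiset (ℕ × ℕ)) : Prop :=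
  ∃ a ∈ S, ∃ b ∈ S, ∃ c ∈ S,
    c.2 ≤ a.2 ∧ a.2 < b.2 ∧ a.1 < b.1 ∧ b.1 ≤ n + 1 ∧ n + 1 < c.1 ∧
    c.1 + b.2 < n + n₁ + 2

open Polynomial in
/-- If leading coefficients with respect to an auxiliary variable are linearly independent in
each degree, then so is the family itself; in the lowest degree it suffices that the
original family is independent. -/
theorem linearIndepOn_of_leadingCoeff {F R ι : Type*} [Field F] [CommRing R] [Algebra F R]
    (θ : R →ₐ[F] R[X]) {p q : ι → R} {e : ι → ℕ} {G : Set ι}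
    (hdeg : ∀ f ∈ G, (θ (p f)).natDegree ≤ e f)
    (hcoeff : ∀ f ∈ G, (θ (p f)).coeff (e f) = q f)
    (h : ∀ d, LinearIndepOn F q {f ∈ G | e f = d} ∨ LinearIndepOn F p {f ∈ G | e f ≤ d}) :
    LinearIndepOn F p G := by
  classical
  rw [linearIndepOn_iff']
  intro t c htG hsum
  by_contra! hne
  obtain ⟨f₀, hf₀t, hf₀⟩ := hne
  obtain ⟨f₁, hf₁, hmax⟩ := Finset.exists_max_image (t.filter fun f => c f ≠ 0) e
    ⟨f₀, by simp [hf₀t, hf₀]⟩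
  rw [Finset.mem_filter] at hf₁
  have hle : ∀ f ∈ t, c f ≠ 0 → e f ≤ e f₁ := fun f hf hc => hmax f (by simp [hf, hc])
  rcases h (e f₁) with h | h
  · rw [linearIndepOn_iff'] at h
    refine hf₁.2 (h (t.filter fun f => e f = e f₁) c ?_ ?_ f₁ (by simp [hf₁.1]))
    · intro f hf
      rw [Finset.mem_coe, Finset.mem_filter] at hf
      exact ⟨htG hf.1, hf.2⟩
    · have hθ : ∑ f ∈ t, c f • (θ (p f)).coeff (e f₁) = 0 := by
        have := congrArg (fun P => (θ P).coeff (e f₁)) hsum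
        simpa [map_sum, Polynomial.finsetSum_coeff] using this
      rw [← hθ, Finset.sum_filter]
      refine Finset.sum_congr rfl fun f hf => ?_
      split_ifs with he
      · rw [← he, hcoeff f (htG hf)]
      · by_cases hc : c f = 0
        · simp [hc]
        · rw [Polynomial.coeff_eq_zero_of_natDegree_lt, smul_zero]
          exact (hdeg f (htG hf)).trans_lt (lt_of_le_of_ne (hle f hf hc) he)
  · rw [linearIndepOn_iff'] at h
    refine hf₁.2 (h (t.filter fun f => c f ≠ 0) c ?_ ?_ f₁ (by simp [hf₁]))
    · intro f hf
      rw [Finset.mem_coe, Finset.mem_filter] at hf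
      exact ⟨htG hf.1, hle f hf.1 hf.2⟩
    · rw [← hsum, Finset.sum_filter]
      refine Finset.sum_congr rfl fun f hf => ?_
      by_cases hc : c f = 0 <;> simp [hc]

theorem LinearIndepOn.of_algHom_eq_mul {F R ι κ : Type*} [Field F] [CommRing R] [IsDomain R]
    [Algebra F R] (θ : R →ₐ[F] R) {u : R} (hu : u ≠ 0) (m : ι → κ) {p : ι → R} {p' : κ → R}
    {G : Set ι} {G' : Set κ} (hθ : ∀ f ∈ G, θ (p f) = u * p' (m f))
    (hm : Set.MapsTo m G G') (hinj : Set.InjOn m G) (h : LinearIndepOn F p' G') :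
    LinearIndepOn F p G := by
  have h' := (h.mono hm.image_subset).comp_of_image hinj
  rw [linearIndepOn_iff'] at h' ⊢
  intro t c htG hsum
  refine h' t c htG ?_
  have := congrArg θ hsum
  rw [map_sum, map_zero] at this
  have hmul : u * ∑ i ∈ t, c i • (p' ∘ m) i = 0 := by
    rw [← this, Finset.mul_sum]
    refine Finset.sum_congr rfl fun f hf => ?_
    rw [map_smul, hθ f (htG hf), mul_smul_comm, Function.comp_apply]
  exact (mul_eq_zero.mp hmul).resolve_left hu

open Polynomial in
theorem Polynomial.natDegree_le_and_coeff_multiset_prod {R α : Type*} [CommRing R]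
    (S : Multiset α) {g : α → R[X]} {d : α → ℕ} {q : α → R}
    (h : ∀ a ∈ S, (g a).natDegree ≤ d a ∧ (g a).coeff (d a) = q a) :
    (S.map g).prod.natDegree ≤ (S.map d).sum ∧
      (S.map g).prod.coeff (S.map d).sum = (S.map q).prod := by
  induction S using Multiset.induction with
  | empty => simp
  | cons a S ih =>
    obtain ⟨ih₁, ih₂⟩ := ih fun b hb => h b (Multiset.mem_cons_of_mem hb)
    obtain ⟨h₁, h₂⟩ := h a (Multiset.mem_cons_self a S)
    simp only [Multiset.map_cons, Multiset.prod_cons, Multiset.sum_cons]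
    exact ⟨Polynomial.natDegree_mul_le_of_le h₁ ih₁,
      by rw [Polynomial.coeff_mul_add_eq_of_natDegree_le h₁ ih₁, h₂, ih₂]⟩

/-- A multiset is determined by its cardinality among the lower parts of a given sum. -/
theorem Multiset.eq_and_eq_of_add_eq_add_of_forall_le {J Y J' Y' : Multiset ℕ}
    (h : J + Y = J' + Y') (hcard : card J = card J') (hle : ∀ a ∈ J, ∀ b ∈ Y, a ≤ b)
    (hle' : ∀ a ∈ J', ∀ b ∈ Y', a ≤ b) : J = J' ∧ Y = Y' := by
  have hp : ((J.sort ++ Y.sort : List ℕ)) = J'.sort ++ Y'.sort := by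
    refine List.Perm.eq_of_pairwise (le := (· ≤ ·)) (fun a b _ _ => le_antisymm) ?_ ?_ ?_
    · rw [List.pairwise_append]
      exact ⟨J.pairwise_sort _, Y.pairwise_sort _, by simpa using hle⟩
    · rw [List.pairwise_append]
      exact ⟨J'.pairwise_sort _, Y'.pairwise_sort _, by simpa using hle'⟩
    · rw [← Multiset.coe_eq_coe, ← Multiset.coe_add, ← Multiset.coe_add]
      simpa using h
  obtain ⟨h₁, h₂⟩ := List.append_inj hp (by simpa using hcard)
  constructor
  · rw [← J.sort_eq (· ≤ ·), h₁, Multiset.sort_eq]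
  · rw [← Y.sort_eq (· ≤ ·), h₂, Multiset.sort_eq]

/-- Replace the value `c` by `c'`. -/
def mergeIdx (c c' i : ℕ) : ℕ := if i = c then c' else i

/-- Two multisets of cells agree if they agree after merging column `c` into column `c'`, provided
column `c` has the same number of cells in both and lies weakly below column `c'`. -/
theorem eq_of_map_mergeIdx_eq {S S' : Multiset (ℕ × ℕ)} {c c' : ℕ} (hcc : c ≠ c')
    (hm : S.map (Prod.map id (mergeIdx c c')) = S'.map (Prod.map id (mergeIdx c c')))
    (hcard : S.countP (fun z => z.2 = c) = S'.countP fun z => z.2 = c)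
    (hS : ∀ z ∈ S, ∀ z' ∈ S, z.2 = c → z'.2 = c' → z.1 ≤ z'.1)
    (hS' : ∀ z ∈ S', ∀ z' ∈ S', z.2 = c → z'.2 = c' → z.1 ≤ z'.1) : S = S' := by
  have key : ∀ T : Multiset (ℕ × ℕ),
      T = (T.filter fun z => z.2 = c) + (T.filter fun z => z.2 = c') +
        T.filter (fun z => z.2 ≠ c ∧ z.2 ≠ c') := by
    intro T
    ext z
    simp only [Multiset.count_add, Multiset.count_filter]
    by_cases h1 : z.2 = c <;> by_cases h2 : z.2 = c' <;> simp_all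
  have hother : ∀ T : Multiset (ℕ × ℕ), T.filter (fun z => z.2 ≠ c ∧ z.2 ≠ c') =
      (T.map (Prod.map id (mergeIdx c c'))).filter (fun z => z.2 ≠ c') := by
    intro T
    rw [Multiset.filter_map]
    have : T.filter ((fun z : ℕ × ℕ => z.2 ≠ c') ∘ Prod.map id (mergeIdx c c')) =
        T.filter (fun z => z.2 ≠ c ∧ z.2 ≠ c') := by
      refine Multiset.filter_congr fun z _ => ?_
      by_cases h1 : z.2 = c <;> simp [mergeIdx, h1]
    rw [this]
    conv_lhs => rw [← Multiset.map_id (T.filter _)]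
    refine Multiset.map_congr rfl fun z hz => ?_
    rw [Multiset.mem_filter] at hz
    simp [mergeIdx, hz.2.1, Prod.map]
  have hcol : ∀ (T : Multiset (ℕ × ℕ)) (i : ℕ), T.filter (fun z => z.2 = i) =
      ((T.filter fun z => z.2 = i).map Prod.fst).map (fun j => (j, i)) := by
    intro T i
    rw [Multiset.map_map]
    conv_lhs => rw [← Multiset.map_id (T.filter _)]
    refine Multiset.map_congr rfl fun z hz => ?_
    rw [Multiset.mem_filter] at hz
    simp [← hz.2]
  have hsum : ∀ T : Multiset (ℕ × ℕ),
      (T.filter fun z => z.2 = c).map Prod.fst + (T.filter fun z => z.2 = c').map Prod.fst =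
      ((T.map (Prod.map id (mergeIdx c c'))).filter (fun z => z.2 = c')).map Prod.fst := by
    intro T
    rw [Multiset.filter_map, Multiset.map_map, ← Multiset.map_add, Multiset.filter_add_filter]
    have h0 : T.filter (fun z => z.2 = c ∧ z.2 = c') = 0 := by
      rw [Multiset.filter_eq_nil]
      rintro z - ⟨h1, h2⟩
      exact hcc (h1.symm.trans h2)
    rw [h0, add_zero]
    have : T.filter ((fun z : ℕ × ℕ => z.2 = c') ∘ Prod.map id (mergeIdx c c')) =
        T.filter (fun z => z.2 = c ∨ z.2 = c') := by
      refine Multiset.filter_congr fun z _ => ?_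
      by_cases h1 : z.2 = c <;> simp [mergeIdx, h1]
    rw [this]
    rfl
  obtain ⟨h1, h2⟩ := Multiset.eq_and_eq_of_add_eq_add_of_forall_le
    (((hsum S).trans (by rw [hm])).trans (hsum S').symm)
    (by simpa [Multiset.countP_eq_card_filter] using hcard)
    (by
      simp only [Multiset.mem_map, Multiset.mem_filter]
      rintro _ ⟨z, ⟨hz, hzc⟩, rfl⟩ _ ⟨z', ⟨hz', hzc'⟩, rfl⟩
      exact hS z hz z' hz' hzc hzc')
    (by
      simp only [Multiset.mem_map, Multiset.mem_filter]
      rintro _ ⟨z, ⟨hz, hzc⟩, rfl⟩ _ ⟨z', ⟨hz', hzc'⟩, rfl⟩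
      exact hS' z hz z' hz' hzc hzc')
  rw [key S, key S', hcol S c, hcol S c', hcol S' c, hcol S' c', h1, h2, hother, hother, hm]

theorem Has3Chain.of_map {S : Multiset (ℕ × ℕ)} {g : ℕ × ℕ → ℕ × ℕ}
    (h₁ : ∀ z ∈ S, ∀ z' ∈ S, (g z).1 < (g z').1 → z.1 < z'.1)
    (h₂ : ∀ z ∈ S, ∀ z' ∈ S, (g z).2 < (g z').2 → z.2 < z'.2)
    (h : Has3Chain (S.map g)) : Has3Chain S := by
  obtain ⟨a', ha', b', hb', c', hc', h⟩ := h
  obtain ⟨a, ha, rfl⟩ := Multiset.mem_map.mp ha'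
  obtain ⟨b, hb, rfl⟩ := Multiset.mem_map.mp hb'
  obtain ⟨c, hc, rfl⟩ := Multiset.mem_map.mp hc'
  exact ⟨a, ha, b, hb, c, hc, h₁ a ha b hb h.1, h₁ b hb c hc h.2.1, h₂ a ha b hb h.2.2.1,
    h₂ b hb c hc h.2.2.2⟩

theorem Has3Chain.mono {S T : Multiset (ℕ × ℕ)} (hST : S ⊆ T) (h : Has3Chain S) :
    Has3Chain T := by
  obtain ⟨a, ha, b, hb, c, hc, h⟩ := h
  exact ⟨a, hST ha, b, hST hb, c, hST hc, h⟩

/-- The polynomial attached to a cell `(j,i)` of a matrix with additional top row `N` and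
additional column `0`: `x_i` in the top row, `y_j` in the column `0`, the corner being `1`, and
`x_i x_j - y_i y_j` elsewhere. -/
noncomputable def cellPoly (F : Type*) [Field F] (N : ℕ) (z : ℕ × ℕ) :
    MvPolynomial (ℕ ⊕ ℕ) F :=
  if z.2 = 0 then (if z.1 = N then 1 else X (Sum.inr z.1))
  else if z.1 = N then X (Sum.inl z.2)
  else X (Sum.inl z.2) * X (Sum.inl z.1) - X (Sum.inr z.2) * X (Sum.inr z.1)

/-- The product of the polynomials of all cells of a multiset. -/
noncomputable def cellProd (F : Type*) [Field F] (N : ℕ) (S : Multiset (ℕ × ℕ)) :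
    MvPolynomial (ℕ ⊕ ℕ) F :=
  (S.map (cellPoly F N)).prod

/-- Multisets of cells without 3-chains, with given multisets of row and column indices
and given number of corner cells. -/
def cellFamily (N k : ℕ) (A B : Multiset ℕ) : Set (Multiset (ℕ × ℕ)) :=
  {S | S.map Prod.fst = A ∧ S.map Prod.snd = B ∧ S.count (N, 0) = k ∧ ¬ Has3Chain S}

theorem countP_fst_eq_count_map (S : Multiset (ℕ × ℕ)) (j : ℕ) :
    S.countP (fun z => z.1 = j) = (S.map Prod.fst).count j := by
  rw [Multiset.count_map, Multiset.countP_eq_card_filter]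
  simp only [eq_comm]

theorem countP_snd_eq_count_map (S : Multiset (ℕ × ℕ)) (i : ℕ) :
    S.countP (fun z => z.2 = i) = (S.map Prod.snd).count i := by
  rw [Multiset.count_map, Multiset.countP_eq_card_filter]
  simp only [eq_comm]

theorem countP_fst_eq_add (S : Multiset (ℕ × ℕ)) (j i : ℕ) :
    S.countP (fun z => z.1 = j) = S.countP (fun z => z.1 = j ∧ z.2 ≠ i) + S.count (j, i) := by
  induction S using Multiset.induction with
  | empty => simp
  | cons z S ih =>
    obtain ⟨a, b⟩ := z
    simp only [Multiset.countP_cons, Multiset.count_cons, ih, Prod.mk.injEq]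
    grind

theorem countP_snd_eq_add (S : Multiset (ℕ × ℕ)) (j i : ℕ) :
    S.countP (fun z => z.2 = i) = S.countP (fun z => z.2 = i ∧ z.1 ≠ j) + S.count (j, i) := by
  induction S using Multiset.induction with
  | empty => simp
  | cons z S ih =>
    obtain ⟨a, b⟩ := z
    simp only [Multiset.countP_cons, Multiset.count_cons, ih, Prod.mk.injEq]
    grind

theorem Multiset.sum_map_ite_one_zero {α : Type*} (S : Multiset α) (p : α → Prop)
    [DecidablePred p] : (S.map fun a => if p a then 1 else 0).sum = S.countP p := by
  induction S using Multiset.induction with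
  | empty => simp
  | cons a S ih => simp [Multiset.countP_cons, ih, add_comm]

section ColumnMerge

variable {F : Type*} [Field F]

/-- The specialization `x_c ↦ 1`, `y_c ↦ -T`. -/
noncomputable def colHom (F : Type*) [Field F] (c : ℕ) :
    MvPolynomial (ℕ ⊕ ℕ) F →ₐ[F] Polynomial (MvPolynomial (ℕ ⊕ ℕ) F) :=
  aeval fun v => if v = Sum.inl c then 1 else if v = Sum.inr c then -Polynomial.X
    else Polynomial.C (X v)

theorem colHom_cellPoly {N c : ℕ} (hc : c ≠ 0) {z : ℕ × ℕ} (hz : z.1 ≠ c) :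
    (colHom F c (cellPoly F N z)).natDegree ≤ (if z.2 = c ∧ z.1 ≠ N then 1 else 0) ∧
    (colHom F c (cellPoly F N z)).coeff (if z.2 = c ∧ z.1 ≠ N then 1 else 0) =
      cellPoly F N (Prod.map id (mergeIdx c 0) z) := by
  obtain ⟨j, i⟩ := z
  dsimp only at hz
  by_cases hi : i = c
  · subst hi
    by_cases hj : j = N
    · simp [cellPoly, colHom, hc, hj, mergeIdx]
    · have : colHom F i (cellPoly F N (j, i)) =
          Polynomial.C (X (Sum.inl j)) + Polynomial.C (X (Sum.inr j)) * Polynomial.X := by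
        simp [cellPoly, colHom, hc, hj, hz]
        ring
      rw [this]
      constructor
      · simp only [hj, ne_eq, not_false_eq_true, and_self, if_true]
        compute_degree
      · simp [hj, cellPoly, mergeIdx]
  · have : colHom F c (cellPoly F N (j, i)) = Polynomial.C (cellPoly F N (j, i)) := by
      unfold cellPoly colHom
      dsimp only
      split_ifs <;> simp [hi, hz]
    rw [this]
    simp [hi, mergeIdx]

theorem mergeIdx_injOn_aux {N c : ℕ} {S S' : Multiset (ℕ × ℕ)} (hc : c ≠ 0)
    (hm : S.map (Prod.map id (mergeIdx c 0)) = S'.map (Prod.map id (mergeIdx c 0)))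
    (he : S.countP (fun z => z.2 = c ∧ z.1 ≠ N) = S'.countP fun z => z.2 = c ∧ z.1 ≠ N)
    (ht : S.count (N, c) = S'.count (N, c))
    (hS : ∀ z ∈ S, ∀ z' ∈ S, z.2 = c → z'.2 = 0 → z.1 ≠ N → z'.1 ≠ N → z.1 ≤ z'.1)
    (hS' : ∀ z ∈ S', ∀ z' ∈ S', z.2 = c → z'.2 = 0 → z.1 ≠ N → z'.1 ≠ N → z.1 ≤ z'.1) :
    S = S' := by
  have hfilter : ∀ (T : Multiset (ℕ × ℕ)) (p : ℕ → Prop) [DecidablePred p],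
      (T.filter fun z => p z.1).map (Prod.map id (mergeIdx c 0)) =
        (T.map (Prod.map id (mergeIdx c 0))).filter fun z => p z.1 := by
    intro T p _
    rw [Multiset.filter_map]
    rfl
  rw [← Multiset.filter_add_not (fun z : ℕ × ℕ => z.1 = N) S,
    ← Multiset.filter_add_not (fun z : ℕ × ℕ => z.1 = N) S']
  congr 1
  · refine eq_of_map_mergeIdx_eq hc (by rw [hfilter S (· = N), hfilter S' (· = N), hm]) ?_ ?_ ?_
    · rw [Multiset.countP_filter, Multiset.countP_filter]
      simpa [Multiset.count, Prod.ext_iff, and_comm, eq_comm] using ht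
    all_goals
      simp only [Multiset.mem_filter]
      rintro z ⟨_, hz⟩ z' ⟨_, hz'⟩ - -
      rw [hz, hz']
  · refine eq_of_map_mergeIdx_eq hc (by rw [hfilter S (¬ · = N), hfilter S' (¬ · = N), hm]) ?_ ?_ ?_
    · rwa [Multiset.countP_filter, Multiset.countP_filter]
    · simp only [Multiset.mem_filter]
      rintro z ⟨hz, hzN⟩ z' ⟨hz', hzN'⟩ h h'
      exact hS z hz z' hz' h h' hzN hzN'
    · simp only [Multiset.mem_filter]
      rintro z ⟨hz, hzN⟩ z' ⟨hz', hzN'⟩ h h'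
      exact hS' z hz z' hz' h h' hzN hzN'

theorem count_map_merge_corner {N c : ℕ} (hc : c ≠ 0) (S : Multiset (ℕ × ℕ)) :
    (S.map (Prod.map id (mergeIdx c 0))).count (N, 0) = S.count (N, 0) + S.count (N, c) := by
  induction S using Multiset.induction with
  | empty => simp
  | cons z S ih =>
    obtain ⟨a, b⟩ := z
    simp only [Multiset.map_cons, Multiset.count_cons, ih, Prod.mk.injEq, Prod.map_apply, id,
      mergeIdx]
    grind

theorem linearIndepOn_cellFamily_of_mergeCol {N n₁ k : ℕ} {A B : Multiset ℕ} {c : ℕ}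
    (hA : ∀ a ∈ A, n₁ < a ∧ a ≤ N) (hc : c ≠ 0) (hcn : c ≤ n₁)
    (hmin : ∀ b ∈ B, b ≠ 0 → c ≤ b) (htop : k < A.count N ∨ B.count 0 ≤ k)
    (hmerge : ∀ k', LinearIndepOn F (cellProd F N) (cellFamily N k' A (B.map (mergeIdx c 0))))
    (hremove : ∀ r, 0 < r → r ≤ A.count N → LinearIndepOn F (cellProd F N)
      (cellFamily N k (A - Multiset.replicate r N) (B - Multiset.replicate r c))) :
    LinearIndepOn F (cellProd F N) (cellFamily N k A B) := by
  have hrow : ∀ S ∈ cellFamily N k A B, ∀ z ∈ S, n₁ < z.1 ∧ z.1 ≤ N := by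
    rintro S ⟨rfl, -⟩ z hz
    exact hA _ (Multiset.mem_map_of_mem _ hz)
  have hcol : ∀ S ∈ cellFamily N k A B, ∀ z ∈ S, z.2 ≠ 0 → c ≤ z.2 := by
    rintro S ⟨-, rfl, -⟩ z hz
    exact hmin _ (Multiset.mem_map_of_mem _ hz)
  have hcount : ∀ S ∈ cellFamily N k A B,
      S.countP (fun z => z.2 = c ∧ z.1 ≠ N) + S.count (N, c) = B.count c := by
    rintro S ⟨-, rfl, -⟩
    rw [← countP_snd_eq_count_map, countP_snd_eq_add S N c]
  have hlead : ∀ S ∈ cellFamily N k A B,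
      (colHom F c (cellProd F N S)).natDegree ≤ S.countP (fun z => z.2 = c ∧ z.1 ≠ N) ∧
      (colHom F c (cellProd F N S)).coeff (S.countP fun z => z.2 = c ∧ z.1 ≠ N) =
        cellProd F N (S.map (Prod.map id (mergeIdx c 0))) := by
    intro S hS
    have := Polynomial.natDegree_le_and_coeff_multiset_prod S
      (fun z hz => colHom_cellPoly (F := F) (N := N) hc
        (by have := hrow S hS z hz; omega : z.1 ≠ c))
    simpa [cellProd, map_multiset_prod, Multiset.map_map, Function.comp_def,
      Multiset.sum_map_ite_one_zero] using this
  refine linearIndepOn_of_leadingCoeff (colHom F c) (fun S hS => (hlead S hS).1)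
    (fun S hS => (hlead S hS).2) fun d => ?_
  by_cases hd : B.count 0 ≤ k ∨ B.count c - d + k < A.count N
  · left
    refine ((hmerge (k + (B.count c - d))).mono ?_).comp_of_image (f := Multiset.map _) ?_
    · rintro _ ⟨S, ⟨hS, hSd⟩, rfl⟩
      have hcS := hcount S hS
      have hrS := hrow S hS
      have hclS := hcol S hS
      obtain ⟨rfl, rfl, rfl, h3⟩ := hS
      refine ⟨by simp [Multiset.map_map], by simp [Multiset.map_map], ?_, ?_⟩
      · rw [count_map_merge_corner hc]
        omega
      · refine fun h => h3 (Has3Chain.of_map (g := Prod.map id (mergeIdx c 0))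
          (fun z _ z' _ h => h) (fun z hz z' hz' h => ?_) h)
        have h1 := hclS z hz
        have h2 := hclS z' hz'
        simp only [Prod.map_snd, mergeIdx] at h
        split_ifs at h <;> omega
    · have hsep : ∀ S ∈ cellFamily N k A B, S.countP (fun z => z.2 = c ∧ z.1 ≠ N) = d →
          ∀ z ∈ S, ∀ z' ∈ S, z.2 = c → z'.2 = 0 → z.1 ≠ N → z'.1 ≠ N → z.1 ≤ z'.1 := by
        intro S hS hSd z hz z' hz' hzc hz'0 hzN hzN'
        have hcS := hcount S hS
        have hrS := hrow S hS
        have hclS := hcol S hS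
        obtain ⟨rfl, rfl, rfl, h3⟩ := hS
        by_contra! hlt
        rcases hd with hd | hd
        · rw [← countP_snd_eq_count_map, countP_snd_eq_add S N 0] at hd
          have : 0 < S.countP fun z => z.2 = 0 ∧ z.1 ≠ N :=
            Multiset.countP_pos.mpr ⟨z', hz', hz'0, hzN'⟩
          omega
        · rw [← countP_fst_eq_count_map, countP_fst_eq_add S N 0] at hd
          have : ∃ w ∈ S, (w.1 = N ∧ w.2 ≠ 0) ∧ w.2 ≠ c := by
            by_contra! hw
            have hle : S.countP (fun z => z.1 = N ∧ z.2 ≠ 0) ≤ S.count (N, c) := by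
              rw [Multiset.countP_congr (p' := fun w => (w.1 = N ∧ w.2 ≠ 0) ∧ w = (N, c)) rfl
                fun w hw' => ?_]
              · rw [Multiset.count, Multiset.countP_eq_card_filter, Multiset.countP_eq_card_filter]
                exact Multiset.card_le_card (Multiset.monotone_filter_right S fun w hw' =>
                  hw'.2.symm)
              · exact propext ⟨fun h => ⟨h, Prod.ext h.1 (hw w hw' h)⟩, fun h => h.1⟩
            omega
          obtain ⟨w, hw, ⟨hwN, hw0⟩, hwc⟩ := this
          have := hclS w hw hw0
          have := hrS z hz
          exact h3 ⟨z', hz', z, hz, w, hw, hlt, by omega, by omega, by omega⟩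
      rintro S ⟨hS, hSd⟩ S' ⟨hS', hSd'⟩ hSS
      exact mergeIdx_injOn_aux (N := N) hc hSS (hSd.trans hSd'.symm)
        (by have := hcount S hS; have := hcount S' hS'; omega) (hsep S hS hSd) (hsep S' hS' hSd')
  · right
    push Not at hd
    set r := A.count N - k with hr
    have hr0 : 0 < r := by omega
    refine LinearIndepOn.of_algHom_eq_mul (AlgHom.id F _) (u := X (Sum.inl c) ^ r)
      (pow_ne_zero _ (X_ne_zero _)) (fun S => S - Multiset.replicate r (N, c)) ?_ ?_ ?_
      (hremove r hr0 (by omega))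
    all_goals
      have hrep : ∀ S ∈ {S ∈ cellFamily N k A B | S.countP (fun z => z.2 = c ∧ z.1 ≠ N) ≤ d},
          S - Multiset.replicate r (N, c) + Multiset.replicate r (N, c) = S := by
        rintro S ⟨hS, hSd⟩
        refine Multiset.sub_add_cancel (Multiset.le_count_iff_replicate_le.mp ?_)
        have := hcount S hS
        omega
    · intro S hS
      conv_lhs => rw [← hrep S hS]
      simp [cellProd, cellPoly, hc, mul_comm]
    · intro S hS
      have h := hrep S hS
      obtain ⟨rfl, rfl, hk, h3⟩ := hS.1
      refine ⟨?_, ?_, ?_, fun h' => h3 (h'.mono (Multiset.subset_of_le (Multiset.sub_le_self _ _)))⟩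
      · conv_rhs => rw [← h]
        simp
      · conv_rhs => rw [← h]
        simp
      · rw [Multiset.count_sub, Multiset.count_replicate, if_neg (by simp [hc]), hk, Nat.sub_zero]
    · intro S hS S' hS' hSS
      rw [← hrep S hS, ← hrep S' hS']
      exact congrArg (· + _) hSS

end ColumnMerge

section RowMerge

variable {F : Type*} [Field F]

/-- The specialization `x_M ↦ T`, `y_M ↦ 1`. -/
noncomputable def rowHom (F : Type*) [Field F] (M : ℕ) :
    MvPolynomial (ℕ ⊕ ℕ) F →ₐ[F] Polynomial (MvPolynomial (ℕ ⊕ ℕ) F) :=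
  aeval fun v => if v = Sum.inl M then Polynomial.X else if v = Sum.inr M then 1
    else Polynomial.C (X v)

theorem rowHom_cellPoly {N M : ℕ} (hM : M ≠ N) {z : ℕ × ℕ} (hz : z.2 ≠ M) :
    (rowHom F M (cellPoly F N z)).natDegree ≤ (if z.1 = M ∧ z.2 ≠ 0 then 1 else 0) ∧
    (rowHom F M (cellPoly F N z)).coeff (if z.1 = M ∧ z.2 ≠ 0 then 1 else 0) =
      cellPoly F N (Prod.map (mergeIdx M N) id z) := by
  obtain ⟨j, i⟩ := z
  dsimp only at hz
  by_cases hj : j = M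
  · subst hj
    by_cases hi : i = 0
    · simp [cellPoly, rowHom, hM, hi, mergeIdx]
    · have : rowHom F j (cellPoly F N (j, i)) =
          Polynomial.C (X (Sum.inl i)) * Polynomial.X - Polynomial.C (X (Sum.inr i)) := by
        simp [cellPoly, rowHom, hi, hM, hz]
      rw [this]
      constructor
      · simp only [hi, ne_eq, not_false_eq_true, and_self, if_true]
        compute_degree
      · simp [hi, cellPoly, mergeIdx]
  · have : rowHom F M (cellPoly F N (j, i)) = Polynomial.C (cellPoly F N (j, i)) := by
      unfold cellPoly rowHom
      dsimp only
      split_ifs <;> simp [hj, hz]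
    rw [this]
    simp [hj, mergeIdx]

theorem linearIndepOn_cellFamily_of_mergeRow {N n₁ k : ℕ} {A B : Multiset ℕ} {M : ℕ}
    (hA : ∀ a ∈ A, n₁ < a ∧ a ≤ N) (hB : ∀ b ∈ B, b ≤ n₁) (hMN : M < N) (hnM : n₁ < M)
    (hmax : ∀ a ∈ A, a ≠ N → a ≤ M) (htop : A.count N ≤ k)
    (hmerge : ∀ k', LinearIndepOn F (cellProd F N) (cellFamily N k' (A.map (mergeIdx M N)) B)) :
    LinearIndepOn F (cellProd F N) (cellFamily N k A B) := by
  have hrow : ∀ S ∈ cellFamily N k A B, ∀ z ∈ S, z.1 ≠ N → z.1 ≤ M := by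
    rintro S ⟨rfl, -⟩ z hz
    exact hmax _ (Multiset.mem_map_of_mem _ hz)
  have hrow' : ∀ S ∈ cellFamily N k A B, ∀ z ∈ S, z.1 ≤ N := by
    rintro S ⟨rfl, -⟩ z hz
    exact (hA _ (Multiset.mem_map_of_mem _ hz)).2
  have hcol : ∀ S ∈ cellFamily N k A B, ∀ z ∈ S, z.2 ≤ n₁ := by
    rintro S ⟨-, rfl, -⟩ z hz
    exact hB _ (Multiset.mem_map_of_mem _ hz)
  have hcount : ∀ S ∈ cellFamily N k A B,
      S.countP (fun z => z.1 = M ∧ z.2 ≠ 0) + S.count (M, 0) = A.count M := by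
    rintro S ⟨rfl, -⟩
    rw [← countP_fst_eq_count_map, countP_fst_eq_add S M 0]
  have hzero : ∀ S ∈ cellFamily N k A B, ∀ z ∈ S, z.1 = N → z.2 = 0 := by
    rintro S ⟨rfl, -, rfl, -⟩ z hz hzN
    by_contra hz0
    rw [← countP_fst_eq_count_map, countP_fst_eq_add S N 0] at htop
    have : 0 < S.countP fun z => z.1 = N ∧ z.2 ≠ 0 := Multiset.countP_pos.mpr ⟨z, hz, hzN, hz0⟩
    omega
  have hlead : ∀ S ∈ cellFamily N k A B,
      (rowHom F M (cellProd F N S)).natDegree ≤ S.countP (fun z => z.1 = M ∧ z.2 ≠ 0) ∧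
      (rowHom F M (cellProd F N S)).coeff (S.countP fun z => z.1 = M ∧ z.2 ≠ 0) =
        cellProd F N (S.map (Prod.map (mergeIdx M N) id)) := by
    intro S hS
    have := Polynomial.natDegree_le_and_coeff_multiset_prod S
      (fun z hz => rowHom_cellPoly (F := F) hMN.ne
        (by have := hcol S hS z hz; omega : z.2 ≠ M))
    simpa [cellProd, map_multiset_prod, Multiset.map_map, Function.comp_def,
      Multiset.sum_map_ite_one_zero] using this
  refine linearIndepOn_of_leadingCoeff (rowHom F M) (fun S hS => (hlead S hS).1)
    (fun S hS => (hlead S hS).2) fun d => Or.inl ?_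
  refine ((hmerge (k + (A.count M - d))).mono ?_).comp_of_image (f := Multiset.map _) ?_
  · rintro _ ⟨S, ⟨hS, hSd⟩, rfl⟩
    have hcS := hcount S hS
    have hrS := hrow S hS
    have hrS' := hrow' S hS
    obtain ⟨rfl, rfl, rfl, h3⟩ := hS
    refine ⟨by simp [Multiset.map_map], by simp [Multiset.map_map], ?_, ?_⟩
    · have : ∀ T : Multiset (ℕ × ℕ), (T.map (Prod.map (mergeIdx M N) id)).count (N, 0) =
          T.count (N, 0) + T.count (M, 0) := by
        intro T
        induction T using Multiset.induction with
        | empty => simp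
        | cons z T ih =>
          obtain ⟨a, b⟩ := z
          simp only [Multiset.map_cons, Multiset.count_cons, ih, Prod.mk.injEq, Prod.map_apply,
            id, mergeIdx]
          grind
      rw [this]
      omega
    · refine fun h => h3 (Has3Chain.of_map (g := Prod.map (mergeIdx M N) id)
        (fun z hz z' hz' h => ?_) (fun z _ z' _ h => h) h)
      have h1 := hrS z hz
      have h1' := hrS' z hz
      have h2 := hrS z' hz'
      have h2' := hrS' z' hz'
      simp only [Prod.map_fst, mergeIdx] at h
      split_ifs at h <;> omega
  · rintro S ⟨hS, hSd⟩ S' ⟨hS', hSd'⟩ hSS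
    have hswap : ∀ T : Multiset (ℕ × ℕ),
        (T.map Prod.swap).map (Prod.map id (mergeIdx N M)) =
          ((T.map (Prod.map (mergeIdx M N) id)).map Prod.swap).map
            (Prod.map id (mergeIdx N M)) := by
      intro T
      simp only [Multiset.map_map]
      refine Multiset.map_congr rfl fun z _ => ?_
      simp only [Function.comp_apply, Prod.map, Prod.swap, mergeIdx, id]
      grind
    have hN : ∀ S ∈ cellFamily N k A B,
        (S.map Prod.swap).countP (fun z => z.2 = N) = A.count N := by
      rintro S ⟨rfl, -⟩
      rw [← countP_fst_eq_count_map, Multiset.countP_map, Multiset.countP_eq_card_filter]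
      rfl
    have hsep : ∀ S ∈ cellFamily N k A B, ∀ z ∈ S.map Prod.swap, ∀ z' ∈ S.map Prod.swap,
        z.2 = N → z'.2 = M → z.1 ≤ z'.1 := by
      intro S hS z hz z' _ hzN _
      obtain ⟨w, hw, rfl⟩ := Multiset.mem_map.mp hz
      simp [hzero S hS w hw hzN]
    refine Multiset.map_injective Prod.swap_injective (eq_of_map_mergeIdx_eq hMN.ne' ?_
      ((hN S hS).trans (hN S' hS').symm) (hsep S hS) (hsep S' hS'))
    rw [hswap S, hswap S']
    exact congrArg _ (congrArg _ hSS)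

end RowMerge

theorem countP_map_mergeIdx_lt {A : Multiset ℕ} {c c' : ℕ} (hcc : c ≠ c') (hcA : c ∈ A) :
    (A.map (mergeIdx c c')).countP (· ≠ c') < A.countP (· ≠ c') := by
  obtain ⟨A, rfl⟩ := Multiset.exists_cons_of_mem hcA
  have : (A.map (mergeIdx c c')).countP (· ≠ c') ≤ A.countP (· ≠ c') := by
    rw [Multiset.countP_map, Multiset.countP_eq_card_filter]
    refine Multiset.card_le_card (Multiset.monotone_filter_right A fun a ha h => ?_)
    simp only [mergeIdx] at ha
    split_ifs at ha <;> simp_all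
  simp only [Multiset.map_cons, Multiset.countP_cons]
  simp [mergeIdx, hcc]
  omega

/-- Products of cells without 3-chains, with given row and column content, are linearly
independent. -/
theorem linearIndepOn_cellFamily (F : Type*) [Field F] (N n₁ : ℕ) (m : ℕ) :
    ∀ (k : ℕ) (A B : Multiset ℕ),
      Multiset.card A + A.countP (· ≠ N) + B.countP (· ≠ 0) ≤ m →
      (∀ a ∈ A, n₁ < a ∧ a ≤ N) → (∀ b ∈ B, b ≤ n₁) →
      LinearIndepOn F (cellProd F N) (cellFamily N k A B) := by
  induction m with
  | zero =>
    intro k A B hm _ _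
    refine (LinearIndepOn.singleton (i := 0) (by simp [cellProd])).mono ?_
    rintro S ⟨rfl, -⟩
    simp_all
  | succ m ih =>
    intro k A B hm hA hB
    by_cases htop : k < A.count N
    · by_cases hcol : ∃ b ∈ B, b ≠ 0
      · obtain ⟨c, hcB, hmin⟩ := Finset.exists_min_image (B.toFinset.filter (· ≠ 0)) id
          (by obtain ⟨b, hb, hb0⟩ := hcol; exact ⟨b, by simp [hb, hb0]⟩)
        simp only [Finset.mem_filter, Multiset.mem_toFinset, id] at hcB hmin
        refine linearIndepOn_cellFamily_of_mergeCol hA hcB.2 (hB c hcB.1)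
          (fun b hb hb0 => hmin b ⟨hb, hb0⟩) (Or.inl htop) (fun k' => ih _ _ _ ?_ hA ?_)
          fun r hr hrN => ih _ _ _ ?_ (fun a ha => hA a (Multiset.mem_of_le
            (Multiset.sub_le_self _ _) ha)) fun b hb => hB b (Multiset.mem_of_le
            (Multiset.sub_le_self _ _) hb)
        · have := countP_map_mergeIdx_lt hcB.2 hcB.1
          omega
        · intro b hb
          obtain ⟨b, hbB, rfl⟩ := Multiset.mem_map.mp hb
          unfold mergeIdx
          have := hB b hbB
          split_ifs <;> omega
        · have h1 := Multiset.card_sub (Multiset.le_count_iff_replicate_le.mp hrN)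
          have h2 := Multiset.card_le_card (Multiset.le_count_iff_replicate_le.mp hrN)
          rw [Multiset.card_replicate] at h1 h2
          have h3 := Multiset.countP_le_of_le (· ≠ N)
            (Multiset.sub_le_self A (Multiset.replicate r N))
          have h4 := Multiset.countP_le_of_le (· ≠ 0)
            (Multiset.sub_le_self B (Multiset.replicate r c))
          omega
      · push Not at hcol
        refine (linearIndepOn_empty F _).mono ?_
        rintro S ⟨rfl, rfl, rfl, -⟩
        rw [← countP_fst_eq_count_map, countP_fst_eq_add S N 0] at htop
        obtain ⟨z, hz, -, hz0⟩ : ∃ z ∈ S, z.1 = N ∧ z.2 ≠ 0 :=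
          Multiset.countP_pos.mp (by omega)
        exact hz0 (hcol _ (Multiset.mem_map_of_mem _ hz))
    · by_cases hrow : ∃ a ∈ A, a ≠ N
      · obtain ⟨M, hMA, hmax⟩ := Finset.exists_max_image (A.toFinset.filter (· ≠ N)) id
          (by obtain ⟨a, ha, haN⟩ := hrow; exact ⟨a, by simp [ha, haN]⟩)
        simp only [Finset.mem_filter, Multiset.mem_toFinset, id] at hMA hmax
        have hM := hA M hMA.1
        refine linearIndepOn_cellFamily_of_mergeRow hA hB (by omega) hM.1
          (fun a ha haN => hmax a ⟨ha, haN⟩) (not_lt.mp htop) fun k' => ih _ _ _ ?_ ?_ hB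
        · have := countP_map_mergeIdx_lt hMA.2 hMA.1
          rw [Multiset.card_map]
          omega
        · intro a ha
          obtain ⟨a, haA, rfl⟩ := Multiset.mem_map.mp ha
          unfold mergeIdx
          have := hA a haA
          split_ifs <;> omega
      · push Not at hrow
        refine (LinearIndepOn.singleton (i := Multiset.replicate (Multiset.card A) (N, 0))
          (by simp [cellProd, cellPoly])).mono ?_
        rintro S ⟨rfl, -, rfl, -⟩
        rw [← countP_fst_eq_count_map, countP_fst_eq_add S N 0] at htop
        rw [Set.mem_singleton_iff, Multiset.card_map, Multiset.eq_replicate]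
        refine ⟨rfl, fun z hz => ?_⟩
        have hzN := hrow _ (Multiset.mem_map_of_mem _ hz)
        refine Prod.ext hzN ?_
        by_contra hz0
        have : 0 < S.countP fun z => z.1 = N ∧ z.2 ≠ 0 :=
          Multiset.countP_pos.mpr ⟨z, hz, hzN, hz0⟩
        omega

section OmegaFamily

variable {F : Type*} [Field F]

/-- The quadric `x_i x_j - y_i y_j` attached to `z = (j,i)`. -/
noncomputable def zPoly (F : Type*) [Field F] (z : ℕ × ℕ) : MvPolynomial (ℕ ⊕ ℕ) F :=
  X (Sum.inl z.2) * X (Sum.inl z.1) - X (Sum.inr z.2) * X (Sum.inr z.1)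

/-- The minor `x_q y_p - x_p y_q` attached to `w = (q,p)`. -/
noncomputable def omegaPoly (F : Type*) [Field F] (w : ℕ × ℕ) : MvPolynomial (ℕ ⊕ ℕ) F :=
  X (Sum.inl w.1) * X (Sum.inr w.2) - X (Sum.inl w.2) * X (Sum.inr w.1)

/-- The product of the `z`-quadrics of the first component and of the `ω`-minors of the second. -/
noncomputable def omegaProd (F : Type*) [Field F] (P : Multiset (ℕ × ℕ) × Multiset (ℕ × ℕ)) :
    MvPolynomial (ℕ ⊕ ℕ) F :=
  (P.1.map (zPoly F)).prod * (P.2.map (omegaPoly F)).prod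

/-- Pairs of a multiset of `z`-indices and a multiset of `k` `ω`-indices with prescribed content
and without chains. -/
structure IsOmegaPair (k : ℕ) (A I : Multiset ℕ)
    (P : Multiset (ℕ × ℕ) × Multiset (ℕ × ℕ)) : Prop where
  map_fst : P.1.map Prod.fst = A
  content : P.1.map Prod.snd + P.2.map Prod.fst + P.2.map Prod.snd = I
  card_eq : Multiset.card P.2 = k
  not_has3Chain : ¬ Has3Chain P.1
  snd_lt_fst : ∀ w ∈ P.2, w.2 < w.1
  snd_le : ∀ w ∈ P.2, ∀ z ∈ P.1, w.2 ≤ z.2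
  fst_le_fst : ∀ w ∈ P.2, ∀ w' ∈ P.2, w.2 < w'.2 → w.1 ≤ w'.1
  fst_le_snd : ∀ w ∈ P.2, ∀ z ∈ P.1, ∀ z' ∈ P.1, z.1 < z'.1 → z.2 < z'.2 → w.1 ≤ z'.2

namespace IsOmegaPair

variable {k a : ℕ} {A I : Multiset ℕ} {P : Multiset (ℕ × ℕ) × Multiset (ℕ × ℕ)}

theorem snd_mem (h : IsOmegaPair k A I P) {z : ℕ × ℕ} (hz : z ∈ P.1) : z.2 ∈ I := by
  rw [← h.content]
  simp only [Multiset.mem_add]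
  exact Or.inl (Or.inl (Multiset.mem_map_of_mem _ hz))

theorem omega_fst_mem (h : IsOmegaPair k A I P) {w : ℕ × ℕ} (hw : w ∈ P.2) : w.1 ∈ I := by
  rw [← h.content]
  simp only [Multiset.mem_add]
  exact Or.inl (Or.inr (Multiset.mem_map_of_mem _ hw))

theorem omega_snd_mem (h : IsOmegaPair k A I P) {w : ℕ × ℕ} (hw : w ∈ P.2) : w.2 ∈ I := by
  rw [← h.content]
  simp only [Multiset.mem_add]
  exact Or.inr (Multiset.mem_map_of_mem _ hw)

theorem fst_mem (h : IsOmegaPair k A I P) {z : ℕ × ℕ} (hz : z ∈ P.1) : z.1 ∈ A := by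
  rw [← h.map_fst]
  exact Multiset.mem_map_of_mem _ hz

theorem lt_omega_fst (h : IsOmegaPair k A I P) (hI : ∀ i ∈ I, a ≤ i) {w : ℕ × ℕ}
    (hw : w ∈ P.2) : a < w.1 :=
  (hI _ (h.omega_snd_mem hw)).trans_lt (h.snd_lt_fst w hw)

theorem count_eq (h : IsOmegaPair k A I P) (hI : ∀ i ∈ I, a ≤ i) :
    I.count a = P.1.countP (fun z => z.2 = a) + P.2.countP fun w => w.2 = a := by
  have h0 : (P.2.map Prod.fst).count a = 0 := by
    rw [Multiset.count_eq_zero]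
    intro ha
    obtain ⟨w, hw, hwa⟩ := Multiset.mem_map.mp ha
    exact (h.lt_omega_fst hI hw).ne' hwa
  rw [← h.content, Multiset.count_add, Multiset.count_add, countP_snd_eq_count_map,
    countP_snd_eq_count_map, h0, add_zero]

/-- If the smallest index occurs at least `k` times, then it occurs in every `ω`-index. -/
theorem snd_eq_of_le_count (h : IsOmegaPair k A I P) (hI : ∀ i ∈ I, a ≤ i)
    (hk : k ≤ I.count a) {w : ℕ × ℕ} (hw : w ∈ P.2) : w.2 = a := by
  by_contra hwa
  have hlt : a < w.2 := lt_of_le_of_ne (hI _ (h.omega_snd_mem hw)) (Ne.symm hwa)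
  rw [h.count_eq hI, Multiset.countP_eq_zero.mpr, zero_add] at hk
  · rw [← h.card_eq] at hk
    exact hwa (Multiset.countP_eq_card.mp (le_antisymm (Multiset.countP_le_card _ _) hk) w hw)
  · intro z hz hza
    have := h.snd_le w hw z hz
    omega

/-- If the smallest index occurs fewer than `k` times, then it occurs in no `z`-index. -/
theorem lt_snd_of_count_lt (h : IsOmegaPair k A I P) (hI : ∀ i ∈ I, a ≤ i)
    (hk : I.count a < k) {z : ℕ × ℕ} (hz : z ∈ P.1) : a < z.2 := by
  refine lt_of_le_of_ne (hI _ (h.snd_mem hz)) fun hza => ?_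
  rw [h.count_eq hI, ← h.card_eq] at hk
  have : P.2.countP (fun w => w.2 = a) = Multiset.card P.2 := by
    rw [Multiset.countP_eq_card]
    intro w hw
    have := h.snd_le w hw z hz
    have := hI _ (h.omega_snd_mem hw)
    omega
  omega

end IsOmegaPair

/-- The specialization `x_a ↦ 0`, `y_a ↦ -1`. -/
noncomputable def omegaSpecHom (F : Type*) [Field F] (a : ℕ) :
    MvPolynomial (ℕ ⊕ ℕ) F →ₐ[F] MvPolynomial (ℕ ⊕ ℕ) F :=
  aeval fun v => if v = Sum.inl a then 0 else if v = Sum.inr a then -1 else X v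

theorem linearIndepOn_omegaProd_of_le_count {n₁ t a k : ℕ} {A I : Multiset ℕ} (ha : 1 ≤ a)
    (han : a ≤ n₁) (hnt : n₁ < t) (hA : ∀ j ∈ A, n₁ < j ∧ j < t)
    (hI : ∀ i ∈ I, a ≤ i ∧ i ≤ n₁) (hk : k ≤ I.count a) :
    LinearIndepOn F (omegaProd F) {P | IsOmegaPair k A I P} := by
  have hI' : ∀ i ∈ I, a ≤ i := fun i hi => (hI i hi).1
  have hz : ∀ z : ℕ × ℕ, n₁ < z.1 → z.1 < t → a ≤ z.2 →
      omegaSpecHom F a (zPoly F z) = cellPoly F t (Prod.map id (mergeIdx a 0) z) := by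
    rintro ⟨j, i⟩ h1 h2 h3
    dsimp only at h1 h2 h3
    have hja : j ≠ a := by omega
    have hjt : j ≠ t := by omega
    have hi0 : i ≠ 0 := by omega
    by_cases hia : i = a
    · simp [omegaSpecHom, zPoly, cellPoly, mergeIdx, hja, hjt, hia]
    · simp [omegaSpecHom, zPoly, cellPoly, mergeIdx, hja, hjt, hi0, hia]
  have hw : ∀ w : ℕ × ℕ, w.2 = a → a < w.1 →
      omegaSpecHom F a (omegaPoly F w) = -1 * cellPoly F t (t, w.1) := by
    rintro ⟨q, p⟩ rfl h
    dsimp only at h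
    have hqp : q ≠ p := by omega
    have hq0 : q ≠ 0 := by omega
    simp [omegaSpecHom, omegaPoly, cellPoly, hqp, hq0]
  refine LinearIndepOn.of_algHom_eq_mul (omegaSpecHom F a) (u := (-1) ^ k)
    (pow_ne_zero _ (neg_ne_zero.mpr one_ne_zero))
    (fun P => P.1.map (Prod.map id (mergeIdx a 0)) + P.2.map fun w => (t, w.1)) ?_ ?_ ?_
    (linearIndepOn_cellFamily F t n₁ _ 0 (A + Multiset.replicate k t)
      ((I - Multiset.replicate k a).map (mergeIdx a 0)) le_rfl ?_ ?_)
  · intro P hP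
    have hP : IsOmegaPair k A I P := hP
    have h1 : P.1.map (fun z => omegaSpecHom F a (zPoly F z)) =
        P.1.map fun z => cellPoly F t (Prod.map id (mergeIdx a 0) z) :=
      Multiset.map_congr rfl fun z hzP => hz z (hA _ (hP.fst_mem hzP)).1
        (hA _ (hP.fst_mem hzP)).2 (hI' _ (hP.snd_mem hzP))
    have h2 : P.2.map (fun w => omegaSpecHom F a (omegaPoly F w)) =
        P.2.map fun w => -1 * cellPoly F t (t, w.1) :=
      Multiset.map_congr rfl fun w hwP => hw w (hP.snd_eq_of_le_count hI' hk hwP)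
        (hP.lt_omega_fst hI' hwP)
    rw [omegaProd, map_mul, map_multiset_prod, map_multiset_prod, Multiset.map_map,
      Multiset.map_map, Function.comp_def, Function.comp_def, h1, h2, Multiset.prod_map_mul,
      Multiset.map_const', Multiset.prod_replicate, hP.card_eq, cellProd, Multiset.map_add,
      Multiset.prod_add, Multiset.map_map, Multiset.map_map]
    simp only [Function.comp_def]
    ring
  · intro P hP
    have hP : IsOmegaPair k A I P := hP
    have hsnd : P.2.map Prod.snd = Multiset.replicate k a := by
      rw [← hP.card_eq, ← Multiset.map_const']
      exact Multiset.map_congr rfl fun w hwP => hP.snd_eq_of_le_count hI' hk hwP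
    have hmerge : ∀ {i i'}, i ∈ I → i' ∈ I → mergeIdx a 0 i < mergeIdx a 0 i' → i < i' := by
      intro i i' hi hi' h
      have := hI' i hi
      have := hI' i' hi'
      unfold mergeIdx at h
      split_ifs at h <;> omega
    refine ⟨?_, ?_, ?_, ?_⟩
    · simp [Multiset.map_map, ← hP.map_fst, ← hP.card_eq]
    · have : I - Multiset.replicate k a = P.1.map Prod.snd + P.2.map Prod.fst := by
        rw [← hP.content, hsnd, Multiset.add_sub_cancel_right]
      rw [this, Multiset.map_add, Multiset.map_add]
      simp only [Multiset.map_map, Function.comp_def, Prod.map_snd]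
      congr 1
      refine Multiset.map_congr rfl fun w hwP => ?_
      have := hP.lt_omega_fst hI' hwP
      rw [mergeIdx, if_neg (by omega)]
    · rw [Multiset.count_eq_zero]
      simp only [Multiset.mem_add, Multiset.mem_map, not_or, not_exists, not_and]
      constructor
      · intro z hzP h
        have := hA _ (hP.fst_mem hzP)
        have := congrArg Prod.fst h
        simp at this
        omega
      · intro w hwP h
        have := hP.lt_omega_fst hI' hwP
        have := congrArg Prod.snd h
        simp at this
        omega
    · rintro ⟨x, hx, y, hy, v, hv, h1, h2, h3, h4⟩
      have hlt : ∀ {x y : ℕ × ℕ}, x ∈ P.1.map (Prod.map id (mergeIdx a 0)) +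
          P.2.map (fun w => (t, w.1)) → y ∈ P.1.map (Prod.map id (mergeIdx a 0)) +
          P.2.map (fun w => (t, w.1)) → x.1 < y.1 →
          ∃ z ∈ P.1, Prod.map id (mergeIdx a 0) z = x := by
        intro x y hx hy hxy
        rw [Multiset.mem_add, Multiset.mem_map] at hx
        refine hx.resolve_right fun hx => ?_
        obtain ⟨w, -, rfl⟩ := Multiset.mem_map.mp hx
        rcases Multiset.mem_add.mp hy with hy | hy
        · obtain ⟨z, hzP, rfl⟩ := Multiset.mem_map.mp hy
          have := hA _ (hP.fst_mem hzP)
          simp at hxy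
          omega
        · obtain ⟨w', -, rfl⟩ := Multiset.mem_map.mp hy
          simp at hxy
      obtain ⟨x, hxP, rfl⟩ := hlt hx hy h1
      obtain ⟨y, hyP, rfl⟩ := hlt hy hv h2
      have hxy := hmerge (hP.snd_mem hxP) (hP.snd_mem hyP) h3
      rcases Multiset.mem_add.mp hv with hv | hv
      · obtain ⟨v, hvP, rfl⟩ := Multiset.mem_map.mp hv
        exact hP.not_has3Chain ⟨x, hxP, y, hyP, v, hvP, h1, h2, hxy,
          hmerge (hP.snd_mem hyP) (hP.snd_mem hvP) h4⟩
      · obtain ⟨w, hwP, rfl⟩ := Multiset.mem_map.mp hv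
        have h5 := hP.fst_le_snd w hwP x hxP y hyP h1 hxy
        have h6 := hI' _ (hP.snd_mem hxP)
        simp only [Prod.map_snd, mergeIdx] at h4
        split_ifs at h4 <;> omega
  · intro P hP P' hP' hPP
    have hP : IsOmegaPair k A I P := hP
    have hP' : IsOmegaPair k A I P' := hP'
    have hinv : ∀ P, IsOmegaPair k A I P →
        P.1 = (P.1.map (Prod.map id (mergeIdx a 0))).map (Prod.map id (mergeIdx 0 a)) := by
      intro P hP
      rw [Multiset.map_map]
      conv_lhs => rw [← Multiset.map_id P.1]
      refine Multiset.map_congr rfl fun z hzP => Prod.ext rfl ?_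
      have := hI' _ (hP.snd_mem hzP)
      simp only [id, Function.comp_apply, Prod.map_snd, mergeIdx]
      split_ifs <;> omega
    have hfilt : ∀ P, IsOmegaPair k A I P →
        P.1.map (Prod.map id (mergeIdx a 0)) =
          (P.1.map (Prod.map id (mergeIdx a 0)) + P.2.map fun w => (t, w.1)).filter
            (fun z => z.1 ≠ t) ∧
        P.2.map (fun w => (t, w.1)) =
          (P.1.map (Prod.map id (mergeIdx a 0)) + P.2.map fun w => (t, w.1)).filter
            (fun z => z.1 = t) := by
      intro P hP
      have hne : ∀ z ∈ P.1.map (Prod.map id (mergeIdx a 0)), z.1 ≠ t := by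
        intro z hz
        obtain ⟨z, hzP, rfl⟩ := Multiset.mem_map.mp hz
        exact (hA _ (hP.fst_mem hzP)).2.ne
      have heq : ∀ z ∈ P.2.map (fun w => (t, w.1)), z.1 = t := by
        intro z hz
        obtain ⟨w, -, rfl⟩ := Multiset.mem_map.mp hz
        rfl
      rw [Multiset.filter_add, Multiset.filter_add, Multiset.filter_eq_self.mpr hne,
        Multiset.filter_eq_self.mpr heq, Multiset.filter_eq_nil.mpr hne,
        Multiset.filter_eq_nil.mpr fun z hz => not_not.mpr (heq z hz)]
      simp
    have h1 := (hfilt P hP).1.trans ((congrArg _ hPP).trans (hfilt P' hP').1.symm)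
    have h2 := (hfilt P hP).2.trans ((congrArg _ hPP).trans (hfilt P' hP').2.symm)
    have h2' : ∀ P, IsOmegaPair k A I P →
        P.2 = (P.2.map fun w => (t, w.1)).map fun z => (z.2, a) := by
      intro P hP
      rw [Multiset.map_map]
      conv_lhs => rw [← Multiset.map_id P.2]
      exact Multiset.map_congr rfl fun w hwP =>
        Prod.ext rfl (hP.snd_eq_of_le_count hI' hk hwP)
    refine Prod.ext ?_ ?_
    · rw [hinv P hP, hinv P' hP', h1]
    · rw [h2' P hP, h2' P' hP', h2]
  · intro j hj
    rcases Multiset.mem_add.mp hj with hj | hj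
    · have := hA j hj
      omega
    · have := Multiset.eq_of_mem_replicate hj
      omega
  · intro i hi
    obtain ⟨i, hiI, rfl⟩ := Multiset.mem_map.mp hi
    have := (hI i (Multiset.mem_of_le (Multiset.sub_le_self _ _) hiI)).2
    unfold mergeIdx
    split_ifs <;> omega

/-- The specialization `x_a ↦ T x_b`, `y_a ↦ T y_b + 1`. -/
noncomputable def omegaMergeHom (F : Type*) [Field F] (a b : ℕ) :
    MvPolynomial (ℕ ⊕ ℕ) F →ₐ[F] Polynomial (MvPolynomial (ℕ ⊕ ℕ) F) :=
  aeval fun v => if v = Sum.inl a then Polynomial.X * Polynomial.C (X (Sum.inl b))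
    else if v = Sum.inr a then Polynomial.X * Polynomial.C (X (Sum.inr b)) + 1
    else Polynomial.C (X v)

theorem omegaMergeHom_zPoly {a b : ℕ} {z : ℕ × ℕ} (h₁ : z.1 ≠ a) (h₂ : z.2 ≠ a) :
    omegaMergeHom F a b (zPoly F z) = Polynomial.C (zPoly F z) := by
  simp [omegaMergeHom, zPoly, h₁, h₂]

theorem omegaMergeHom_omegaPoly {a b : ℕ} {w : ℕ × ℕ} (hw : w.1 ≠ a) :
    (omegaMergeHom F a b (omegaPoly F w)).natDegree ≤ (if w.2 = a ∧ w.1 ≠ b then 1 else 0) ∧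
    (omegaMergeHom F a b (omegaPoly F w)).coeff (if w.2 = a ∧ w.1 ≠ b then 1 else 0) =
      if w = (b, a) then X (Sum.inl b) else omegaPoly F (Prod.map id (mergeIdx a b) w) := by
  obtain ⟨q, p⟩ := w
  dsimp only at hw
  by_cases hp : p = a
  · subst hp
    have h : omegaMergeHom F p b (omegaPoly F (q, p)) =
        Polynomial.C (omegaPoly F (q, b)) * Polynomial.X + Polynomial.C (X (Sum.inl q)) := by
      simp [omegaMergeHom, omegaPoly, hw]
      ring
    rw [h]
    by_cases hq : q = b
    · subst hq
      simp [omegaPoly]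
    · constructor
      · simp only [hq, ne_eq, not_false_eq_true, and_self, if_true]
        compute_degree
      · simp [hq, mergeIdx]
  · have h : omegaMergeHom F a b (omegaPoly F (q, p)) = Polynomial.C (omegaPoly F (q, p)) := by
      simp [omegaMergeHom, omegaPoly, hw, hp]
    rw [h]
    simp [hp, mergeIdx]

theorem linearIndepOn_omegaProd_of_merge {n₁ a k : ℕ} {A I : Multiset ℕ}
    (han : a ≤ n₁) (hA : ∀ j ∈ A, n₁ < j) (hI : ∀ i ∈ I, a ≤ i) (hk : I.count a < k)
    (hmerge : ∀ r, LinearIndepOn F (omegaProd F) {P | IsOmegaPair (k - r) A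
      ((I - Multiset.replicate r (a + 1) - Multiset.replicate r a).map (mergeIdx a (a + 1))) P}) :
    LinearIndepOn F (omegaProd F) {P | IsOmegaPair k A I P} := by
  set d : Multiset (ℕ × ℕ) → ℕ := fun W => W.countP fun w => w.2 = a ∧ w.1 ≠ a + 1 with hd
  have hlead : ∀ P, IsOmegaPair k A I P →
      (omegaMergeHom F a (a + 1) (omegaProd F P)).natDegree ≤ d P.2 ∧
      (omegaMergeHom F a (a + 1) (omegaProd F P)).coeff (d P.2) = (P.1.map (zPoly F)).prod *
        (P.2.map fun w => if w = (a + 1, a) then X (Sum.inl (a + 1)) else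
          omegaPoly F (Prod.map id (mergeIdx a (a + 1)) w)).prod := by
    intro P hP
    have hW := Polynomial.natDegree_le_and_coeff_multiset_prod P.2 fun w hw =>
      omegaMergeHom_omegaPoly (F := F) (b := a + 1) (hP.lt_omega_fst hI hw).ne'
    have hZ : P.1.map (fun z => omegaMergeHom F a (a + 1) (zPoly F z)) =
        P.1.map fun z => Polynomial.C (zPoly F z) := by
      refine Multiset.map_congr rfl fun z hz => omegaMergeHom_zPoly ?_ ?_
      · have := hA _ (hP.fst_mem hz)
        omega
      · exact (hP.lt_snd_of_count_lt hI hk hz).ne'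
    have : omegaMergeHom F a (a + 1) (omegaProd F P) =
        Polynomial.C (P.1.map (zPoly F)).prod *
          (P.2.map fun w => omegaMergeHom F a (a + 1) (omegaPoly F w)).prod := by
      rw [omegaProd, map_mul, map_multiset_prod, map_multiset_prod, map_multiset_prod,
        Multiset.map_map, Multiset.map_map, Multiset.map_map]
      simp only [Function.comp_def, hZ]
    rw [Multiset.sum_map_ite_one_zero] at hW
    rw [this, Polynomial.coeff_C_mul, hW.2]
    exact ⟨(Polynomial.natDegree_C_mul_le _ _).trans hW.1, rfl⟩
  refine linearIndepOn_of_leadingCoeff (omegaMergeHom F a (a + 1)) (fun P hP => (hlead P hP).1)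
    (fun P hP => (hlead P hP).2) fun e => Or.inl ?_
  set r := I.count a - e with hr
  have hsplit : ∀ P, IsOmegaPair k A I P → d P.2 = e →
      P.2 = P.2.filter (· ≠ (a + 1, a)) + Multiset.replicate r (a + 1, a) := by
    intro P hP hPe
    have hc := hP.count_eq hI
    rw [Multiset.countP_eq_zero.mpr fun z hz => (hP.lt_snd_of_count_lt hI hk hz).ne', zero_add,
      countP_snd_eq_add P.2 (a + 1) a] at hc
    have : P.2.count (a + 1, a) = r := by
      simp only [hd] at hPe
      omega
    conv_lhs => rw [← Multiset.filter_add_not (· = (a + 1, a)) P.2]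
    rw [Multiset.filter_eq', this, add_comm]
  refine LinearIndepOn.of_algHom_eq_mul (AlgHom.id F _) (u := X (Sum.inl (a + 1)) ^ r)
    (pow_ne_zero _ (X_ne_zero _)) (fun P => (P.1, (P.2.filter (· ≠ (a + 1, a))).map
      (Prod.map id (mergeIdx a (a + 1))))) ?_ ?_ ?_ (hmerge r)
  · rintro P ⟨hP, hPe⟩
    have hcongr : (P.2.filter (· ≠ (a + 1, a))).map (fun w => if w = (a + 1, a) then
        X (Sum.inl (a + 1)) else omegaPoly F (Prod.map id (mergeIdx a (a + 1)) w)) =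
        (P.2.filter (· ≠ (a + 1, a))).map
          fun w => omegaPoly F (Prod.map id (mergeIdx a (a + 1)) w) :=
      Multiset.map_congr rfl fun w hw => if_neg (Multiset.mem_filter.mp hw).2
    conv_lhs => rw [hsplit P hP hPe]
    rw [Multiset.map_add, Multiset.prod_add, hcongr, Multiset.map_replicate,
      Multiset.prod_replicate, if_pos rfl, omegaProd, Multiset.map_map]
    simp only [AlgHom.id_apply, Function.comp_def]
    ring
  · rintro P ⟨hP, hPe⟩
    have hs := hsplit P hP hPe
    set W := P.2.filter (· ≠ (a + 1, a)) with hW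
    have hmem : ∀ w ∈ W, w ∈ P.2 ∧ w ≠ (a + 1, a) := fun w hw => Multiset.mem_filter.mp hw
    have hbd : ∀ w ∈ W, a ≤ w.2 ∧ a < w.1 := fun w hw =>
      ⟨hI _ (hP.omega_snd_mem (hmem w hw).1), hP.lt_omega_fst hI (hmem w hw).1⟩
    refine ⟨hP.map_fst, ?_, ?_, hP.not_has3Chain, ?_, ?_, ?_, ?_⟩
    · have h1 : I - Multiset.replicate r (a + 1) - Multiset.replicate r a =
          P.1.map Prod.snd + W.map Prod.fst + W.map Prod.snd := by
        rw [← hP.content, hs, Multiset.map_add, Multiset.map_add, Multiset.map_replicate,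
          Multiset.map_replicate, tsub_tsub]
        refine tsub_eq_of_eq_add ?_
        abel
      have h2 : (P.1.map Prod.snd).map (mergeIdx a (a + 1)) = P.1.map Prod.snd := by
        conv_rhs => rw [← Multiset.map_id (P.1.map Prod.snd)]
        refine Multiset.map_congr rfl fun i hi => ?_
        obtain ⟨z, hz, rfl⟩ := Multiset.mem_map.mp hi
        exact if_neg (hP.lt_snd_of_count_lt hI hk hz).ne'
      have h3 : (W.map Prod.fst).map (mergeIdx a (a + 1)) = W.map Prod.fst := by
        conv_rhs => rw [← Multiset.map_id (W.map Prod.fst)]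
        refine Multiset.map_congr rfl fun i hi => ?_
        obtain ⟨w, hw, rfl⟩ := Multiset.mem_map.mp hi
        exact if_neg (hbd w hw).2.ne'
      rw [h1, Multiset.map_add, Multiset.map_add, h2, h3]
      simp [Multiset.map_map, hW]
    · have := congrArg Multiset.card hs
      rw [hP.card_eq, Multiset.card_add, Multiset.card_replicate] at this
      change Multiset.card (W.map _) = k - r
      rw [Multiset.card_map]
      omega
    · intro w' hw'
      obtain ⟨w, hw, rfl⟩ := Multiset.mem_map.mp hw'
      have h1 := hP.snd_lt_fst w (hmem w hw).1
      have h2 := (hmem w hw).2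
      rw [ne_eq, Prod.ext_iff] at h2
      simp only [Prod.map_fst, Prod.map_snd, id, mergeIdx]
      split_ifs <;> omega
    · intro w' hw' z hz
      obtain ⟨w, hw, rfl⟩ := Multiset.mem_map.mp hw'
      have h1 := hP.snd_le w (hmem w hw).1 z hz
      have h2 := hP.lt_snd_of_count_lt hI hk hz
      simp only [Prod.map_snd, mergeIdx]
      split_ifs <;> omega
    · intro w₁ hw₁ w₂ hw₂ hlt
      obtain ⟨w, hw, rfl⟩ := Multiset.mem_map.mp hw₁
      obtain ⟨w', hw', rfl⟩ := Multiset.mem_map.mp hw₂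
      refine hP.fst_le_fst w (hmem w hw).1 w' (hmem w' hw').1 ?_
      have := hbd w hw
      have := hbd w' hw'
      simp only [Prod.map_snd, mergeIdx] at hlt
      split_ifs at hlt <;> omega
    · intro w' hw'
      obtain ⟨w, hw, rfl⟩ := Multiset.mem_map.mp hw'
      exact hP.fst_le_snd w (hmem w hw).1
  · rintro P ⟨hP, hPe⟩ P' ⟨hP', hPe'⟩ hPP
    have hPP := Prod.ext_iff.mp hPP
    refine Prod.ext hPP.1 ?_
    rw [hsplit P hP hPe, hsplit P' hP' hPe']
    congr 1
    have hcount : ∀ W : Multiset (ℕ × ℕ),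
        (W.filter (· ≠ (a + 1, a))).countP (fun w => w.2 = a) = d W := by
      intro W
      rw [Multiset.countP_filter]
      refine Multiset.countP_congr rfl fun w _ => ?_
      simp only [ne_eq, Prod.ext_iff, eq_iff_iff]
      tauto
    refine eq_of_map_mergeIdx_eq (Nat.succ_ne_self a).symm hPP.2
      (by rw [hcount, hcount, hPe, hPe']) ?_ ?_
    · intro z hz z' hz' h h'
      exact hP.fst_le_fst z (Multiset.mem_filter.mp hz).1 z' (Multiset.mem_filter.mp hz').1
        (by omega)
    · intro z hz z' hz' h h'
      exact hP'.fst_le_fst z (Multiset.mem_filter.mp hz).1 z' (Multiset.mem_filter.mp hz').1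
        (by omega)

theorem linearIndepOn_omegaProd (F : Type*) [Field F] {n₁ t : ℕ} (hnt : n₁ < t) (m : ℕ) :
    ∀ (a k : ℕ) (A I : Multiset ℕ), n₁ + 1 ≤ m + a → 1 ≤ a → (∀ j ∈ A, n₁ < j ∧ j < t) →
      (∀ i ∈ I, a ≤ i ∧ i ≤ n₁) → LinearIndepOn F (omegaProd F) {P | IsOmegaPair k A I P} := by
  induction m with
  | zero =>
    intro a k A I hm _ _ hI
    refine (LinearIndepOn.singleton (i := (0, 0)) (by simp [omegaProd])).mono ?_
    intro P hP
    have hP : IsOmegaPair k A I P := hP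
    refine Prod.ext ?_ ?_
    · refine Multiset.eq_zero_of_forall_notMem fun z hz => ?_
      have := hI _ (hP.snd_mem hz)
      omega
    · refine Multiset.eq_zero_of_forall_notMem fun w hw => ?_
      have := hI _ (hP.omega_snd_mem hw)
      omega
  | succ m ih =>
    intro a k A I hm ha hA hI
    by_cases hk : k ≤ I.count a
    · by_cases han : a ≤ n₁
      · exact linearIndepOn_omegaProd_of_le_count ha han hnt hA hI hk
      · exact ih a k A I (by omega) ha hA hI
    · by_cases han : a < n₁
      · refine linearIndepOn_omegaProd_of_merge han.le (fun j hj => (hA j hj).1)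
          (fun i hi => (hI i hi).1) (not_le.mp hk) fun r =>
            ih (a + 1) _ _ _ (by omega) (by omega) hA ?_
        intro i hi
        obtain ⟨i, hiI, rfl⟩ := Multiset.mem_map.mp hi
        have := hI i (Multiset.mem_of_le ((Multiset.sub_le_self _ _).trans
          (Multiset.sub_le_self _ _)) hiI)
        unfold mergeIdx
        split_ifs <;> omega
      · refine (linearIndepOn_empty F _).mono fun P hP => ?_
        have hP : IsOmegaPair k A I P := hP
        obtain ⟨w, hw⟩ := Multiset.card_pos_iff_exists_mem.mp
          (show 0 < Multiset.card P.2 by rw [hP.card_eq]; omega)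
        have h1 := hI _ (hP.omega_fst_mem hw)
        have h2 := hI _ (hP.omega_snd_mem hw)
        have h3 := hP.snd_lt_fst w hw
        omega

end OmegaFamily

theorem LinearIndepOn.linearIndependent_subtype {F V ι : Type*} [Semiring F] [AddCommMonoid V]
    [Module F V] {v : ι → V} {P Q : ι → Prop} (h : LinearIndepOn F v {f | Q f})
    (hPQ : ∀ f, P f → Q f) : LinearIndependent F fun f : {f // P f} => v f.val :=
  LinearIndependent.comp h (fun f : {f // P f} => ⟨f.1, hPQ f.1 f.2⟩) fun _ _ hff =>
    Subtype.ext (Subtype.ext_iff.mp hff :)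

/-- Formal products with prescribed numbers of factors and prescribed content, and without
3-chains, `ω`-2-chains and `ω`-3-chains. -/
structure IsChainFreeProd (n n₁ k₁ k₂ k₃ k₄ : ℕ) (I₁ I₃ : Multiset ℕ) (f : FormalProd) :
    Prop where
  card_x : Multiset.card f.1 = k₁
  card_y : Multiset.card f.2.1 = k₂
  card_z : Multiset.card f.2.2.1 = k₃
  card_omega : Multiset.card f.2.2.2 = k₄
  x_mem : ∀ a ∈ f.1, 1 ≤ a ∧ a ≤ n₁
  y_mem : ∀ b ∈ f.2.1, n₁ + 1 ≤ b ∧ b ≤ n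
  z_mem : ∀ z ∈ f.2.2.1, (n₁ + 1 ≤ z.1 ∧ z.1 ≤ n) ∧ (1 ≤ z.2 ∧ z.2 ≤ n₁)
  omega_mem : ∀ w ∈ f.2.2.2, 1 ≤ w.2 ∧ w.2 < w.1 ∧ w.1 ≤ n₁
  idx1_eq : idx1 f = I₁
  idx3_eq : idx3 f = I₃
  not_has3Chain : ¬ Has3Chain (idxI n n₁ f)
  not_hasOmega2Chain : ¬ HasOmega2Chain n (idxI n n₁ f)
  not_hasOmega3Chain : ¬ HasOmega3Chain n n₁ (idxI n n₁ f)

section IdxI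

variable {n n₁ : ℕ} {f : FormalProd}

theorem x_mem_idxI {a : ℕ} (ha : a ∈ f.1) : (n + 1, a) ∈ idxI n n₁ f := by
  simp [idxI, ha]

theorem y_mem_idxI {b : ℕ} (hb : b ∈ f.2.1) : (b, 0) ∈ idxI n n₁ f := by
  simp [idxI, hb]

theorem z_mem_idxI {z : ℕ × ℕ} (hz : z ∈ f.2.2.1) : z ∈ idxI n n₁ f := by
  simp [idxI, hz]

theorem omega_mem_idxI {w : ℕ × ℕ} (hw : w ∈ f.2.2.2) :
    (n + n₁ + 2 - w.1, w.2) ∈ idxI n n₁ f := by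
  unfold idxI
  exact Multiset.mem_add.mpr (Or.inr (Multiset.mem_map_of_mem
    (fun w : ℕ × ℕ => (n + n₁ + 2 - w.1, w.2)) hw))

end IdxI

theorem phiTilde_eq_cellProd (F : Type*) [Field F] {n n₁ k₁ k₂ k₃ : ℕ} {I₁ I₃ : Multiset ℕ}
    {f : FormalProd} (hf : IsChainFreeProd n n₁ k₁ k₂ k₃ 0 I₁ I₃ f) :
    phiTilde F f = cellProd F (n + 1) (idxI n n₁ f) := by
  have h0 : f.2.2.2 = 0 := Multiset.card_eq_zero.mp hf.card_omega
  have hx : f.1.map (fun a => cellPoly F (n + 1) (n + 1, a)) =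
      f.1.map fun a => X (Sum.inl a) := by
    refine Multiset.map_congr rfl fun a ha => ?_
    have := hf.x_mem a ha
    rw [cellPoly, if_neg (by dsimp only; omega), if_pos rfl]
  have hy : f.2.1.map (fun b => cellPoly F (n + 1) (b, 0)) =
      f.2.1.map fun b => X (Sum.inr b) := by
    refine Multiset.map_congr rfl fun b hb => ?_
    have := hf.y_mem b hb
    rw [cellPoly, if_pos rfl, if_neg (by dsimp only; omega)]
  have hz : f.2.2.1.map (cellPoly F (n + 1)) = f.2.2.1.map fun z =>
      X (Sum.inl z.2) * X (Sum.inl z.1) - X (Sum.inr z.2) * X (Sum.inr z.1) := by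
    refine Multiset.map_congr rfl fun z hz => ?_
    have := hf.z_mem z hz
    rw [cellPoly, if_neg (by omega), if_neg (by omega)]
  rw [phiTilde, cellProd, idxI, h0]
  simp only [Multiset.map_add, Multiset.map_map, Function.comp_def, Multiset.prod_add, hx, hy, hz,
    Multiset.map_zero, Multiset.prod_zero, mul_one]

theorem linearIndepOn_phiTilde_of_omega_eq_zero (F : Type*) [Field F] {n n₁ : ℕ} (h2 : n₁ < n)
    (k₁ k₂ k₃ : ℕ) {I₁ I₃ : Multiset ℕ} (hI₁ : ∀ a ∈ I₁, 1 ≤ a ∧ a ≤ n₁)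
    (hI₃ : ∀ b ∈ I₃, n₁ + 1 ≤ b ∧ b ≤ n) :
    LinearIndepOn F (phiTilde F) {f | IsChainFreeProd n n₁ k₁ k₂ k₃ 0 I₁ I₃ f} := by
  refine LinearIndepOn.of_algHom_eq_mul (AlgHom.id F _) one_ne_zero (idxI n n₁)
    (fun f hf => by rw [one_mul, AlgHom.id_apply]; exact phiTilde_eq_cellProd F hf) ?_ ?_
    (linearIndepOn_cellFamily F (n + 1) n₁ _ 0 (I₃ + Multiset.replicate k₁ (n + 1))
      (I₁ + Multiset.replicate k₂ 0) le_rfl ?_ ?_)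
  · intro f hf
    have hf : IsChainFreeProd n n₁ k₁ k₂ k₃ 0 I₁ I₃ f := hf
    have h0 : f.2.2.2 = 0 := Multiset.card_eq_zero.mp hf.card_omega
    refine ⟨?_, ?_, ?_, hf.not_has3Chain⟩
    · rw [← hf.idx3_eq, idx3, idxI, h0, ← hf.card_x]
      simp only [Multiset.map_add, Multiset.map_map, Function.comp_def, Multiset.map_const',
        Multiset.map_id', Multiset.map_zero]
      abel
    · rw [← hf.idx1_eq, idx1, idxI, h0, ← hf.card_y]
      simp only [Multiset.map_add, Multiset.map_map, Function.comp_def, Multiset.map_const',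
        Multiset.map_id', Multiset.map_zero]
      abel
    · rw [Multiset.count_eq_zero, idxI, h0]
      simp only [Multiset.map_zero, add_zero, Multiset.mem_add, Multiset.mem_map, Prod.mk.injEq,
        not_or, not_exists, not_and]
      refine ⟨⟨fun a ha _ => ?_, fun b hb h => ?_⟩, fun hz => ?_⟩
      · have := hf.x_mem a ha
        omega
      · have := hf.y_mem b hb
        omega
      · have := hf.z_mem _ hz
        dsimp only at this
        omega
  · have key : ∀ f, IsChainFreeProd n n₁ k₁ k₂ k₃ 0 I₁ I₃ f →
        f = (((idxI n n₁ f).filter (fun z => z.1 = n + 1)).map Prod.snd,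
          ((idxI n n₁ f).filter (fun z => z.2 = 0)).map Prod.fst,
          (idxI n n₁ f).filter (fun z => z.1 ≠ n + 1 ∧ z.2 ≠ 0), 0) := by
      intro f hf
      have h0 : f.2.2.2 = 0 := Multiset.card_eq_zero.mp hf.card_omega
      have hx : ∀ z ∈ f.1.map (fun a => (n + 1, a)), z.1 = n + 1 ∧ z.2 ≠ 0 := by
        intro z hz
        obtain ⟨a, ha, rfl⟩ := Multiset.mem_map.mp hz
        have := hf.x_mem a ha
        exact ⟨rfl, by dsimp only; omega⟩
      have hy : ∀ z ∈ f.2.1.map (fun b => (b, 0)), z.1 ≠ n + 1 ∧ z.2 = 0 := by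
        intro z hz
        obtain ⟨b, hb, rfl⟩ := Multiset.mem_map.mp hz
        have := hf.y_mem b hb
        exact ⟨by dsimp only; omega, rfl⟩
      have hz : ∀ z ∈ f.2.2.1, z.1 ≠ n + 1 ∧ z.2 ≠ 0 := by
        intro z hz
        have := hf.z_mem z hz
        omega
      have hfx : (idxI n n₁ f).filter (fun z => z.1 = n + 1) = f.1.map fun a => (n + 1, a) := by
        rw [idxI, h0, Multiset.map_zero, add_zero, Multiset.filter_add, Multiset.filter_add,
          Multiset.filter_eq_self.mpr fun z h => (hx z h).1,
          Multiset.filter_eq_nil.mpr fun z h => (hy z h).1,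
          Multiset.filter_eq_nil.mpr fun z h => (hz z h).1, add_zero, add_zero]
      have hfy : (idxI n n₁ f).filter (fun z => z.2 = 0) = f.2.1.map fun b => (b, 0) := by
        rw [idxI, h0, Multiset.map_zero, add_zero, Multiset.filter_add, Multiset.filter_add,
          Multiset.filter_eq_nil.mpr fun z h => (hx z h).2,
          Multiset.filter_eq_self.mpr fun z h => (hy z h).2,
          Multiset.filter_eq_nil.mpr fun z h => (hz z h).2, zero_add, add_zero]
      have hfz : (idxI n n₁ f).filter (fun z => z.1 ≠ n + 1 ∧ z.2 ≠ 0) = f.2.2.1 := by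
        rw [idxI, h0, Multiset.map_zero, add_zero, Multiset.filter_add, Multiset.filter_add,
          Multiset.filter_eq_nil.mpr fun z h => not_and_of_not_left _ (not_not.mpr (hx z h).1),
          Multiset.filter_eq_nil.mpr fun z h => not_and_of_not_right _ (not_not.mpr (hy z h).2),
          Multiset.filter_eq_self.mpr hz, zero_add, zero_add]
      rw [hfx, hfy, hfz, ← h0, Multiset.map_map, Multiset.map_map]
      simp only [Function.comp_def, Multiset.map_id']
      rfl
    intro f hf f' hf' hff
    rw [key f hf, key f' hf', hff]
  · intro j hj
    rcases Multiset.mem_add.mp hj with hj | hj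
    · have := hI₃ j hj
      omega
    · have := Multiset.eq_of_mem_replicate hj
      omega
  · intro i hi
    rcases Multiset.mem_add.mp hi with hi | hi
    · exact (hI₁ i hi).2
    · rw [Multiset.eq_of_mem_replicate hi]
      exact Nat.zero_le _

/-- The endomorphism turning the variables `x_a`, `a ≤ n₁`, into `z`-quadrics in the row `M`,
and multiplying all `z`-quadrics and `ω`-minors by `x_M`. -/
noncomputable def homogenizeHom (F : Type*) [Field F] (n₁ M : ℕ) :
    MvPolynomial (ℕ ⊕ ℕ) F →ₐ[F] MvPolynomial (ℕ ⊕ ℕ) F :=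
  aeval (Sum.elim
    (fun a => if a ≤ n₁ then zPoly F (M, a) else X (Sum.inl a))
    (fun b => if b ≤ n₁ then X (Sum.inr b) else
      X (Sum.inr b) * X (Sum.inl M) - X (Sum.inl b) * X (Sum.inr M)))

section Homogenize

variable {F : Type*} [Field F] {n₁ : ℕ} (M : ℕ)

theorem homogenizeHom_X {a : ℕ} (ha : a ≤ n₁) :
    homogenizeHom F n₁ M (X (Sum.inl a)) = zPoly F (M, a) := by
  simp [homogenizeHom, ha]

theorem homogenizeHom_zPoly {z : ℕ × ℕ} (h₁ : n₁ < z.1) (h₂ : z.2 ≤ n₁) :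
    homogenizeHom F n₁ M (zPoly F z) = X (Sum.inl M) * zPoly F z := by
  simp [homogenizeHom, zPoly, not_le.mpr h₁, h₂]
  ring

theorem homogenizeHom_omegaPoly {w : ℕ × ℕ} (h₁ : w.1 ≤ n₁) (h₂ : w.2 ≤ n₁) :
    homogenizeHom F n₁ M (omegaPoly F w) = X (Sum.inl M) * omegaPoly F w := by
  simp [homogenizeHom, omegaPoly, zPoly, h₁, h₂]
  ring

end Homogenize

theorem linearIndepOn_phiTilde_of_y_eq_zero (F : Type*) [Field F] {n n₁ : ℕ} (h2 : n₁ < n)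
    (k₁ k₃ k₄ : ℕ) {I₁ I₃ : Multiset ℕ} (hI₁ : ∀ a ∈ I₁, 1 ≤ a ∧ a ≤ n₁)
    (hI₃ : ∀ b ∈ I₃, n₁ + 1 ≤ b ∧ b ≤ n) :
    LinearIndepOn F (phiTilde F) {f | IsChainFreeProd n n₁ k₁ 0 k₃ k₄ I₁ I₃ f} := by
  refine LinearIndepOn.of_algHom_eq_mul (homogenizeHom F n₁ (n + 1))
    (u := X (Sum.inl (n + 1)) ^ (k₃ + k₄)) (pow_ne_zero _ (X_ne_zero _))
    (fun f => (f.2.2.1 + f.1.map fun a => (n + 1, a), f.2.2.2)) ?_ ?_ ?_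
    (linearIndepOn_omegaProd F (t := n + 2) (by omega : n₁ < n + 2) n₁ 1 k₄
      (I₃ + Multiset.replicate k₁ (n + 1)) I₁ le_rfl le_rfl ?_ hI₁)
  · intro f hf
    have hf : IsChainFreeProd n n₁ k₁ 0 k₃ k₄ I₁ I₃ f := hf
    have h0 : f.2.1 = 0 := Multiset.card_eq_zero.mp hf.card_y
    have hx : f.1.map (fun a => homogenizeHom F n₁ (n + 1) (X (Sum.inl a))) =
        f.1.map fun a => zPoly F (n + 1, a) :=
      Multiset.map_congr rfl fun a ha => homogenizeHom_X _ (hf.x_mem a ha).2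
    have hz : f.2.2.1.map (fun z => homogenizeHom F n₁ (n + 1) (zPoly F z)) =
        f.2.2.1.map fun z => X (Sum.inl (n + 1)) * zPoly F z :=
      Multiset.map_congr rfl fun z hz =>
        homogenizeHom_zPoly _ (hf.z_mem z hz).1.1 (hf.z_mem z hz).2.2
    have hw : f.2.2.2.map (fun w => homogenizeHom F n₁ (n + 1) (omegaPoly F w)) =
        f.2.2.2.map fun w => X (Sum.inl (n + 1)) * omegaPoly F w := by
      refine Multiset.map_congr rfl fun w hw => ?_
      have := hf.omega_mem w hw
      exact homogenizeHom_omegaPoly _ this.2.2 (by omega)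
    have hphi : phiTilde F f = (f.1.map fun a => X (Sum.inl a)).prod *
        (f.2.2.1.map (zPoly F)).prod * (f.2.2.2.map (omegaPoly F)).prod := by
      rw [phiTilde, h0, Multiset.map_zero, Multiset.prod_zero, mul_one]
      rfl
    rw [hphi, map_mul, map_mul, map_multiset_prod, map_multiset_prod, map_multiset_prod,
      Multiset.map_map, Multiset.map_map, Multiset.map_map]
    simp only [Function.comp_def, hx, hz, hw, Multiset.prod_map_mul, Multiset.map_const',
      Multiset.prod_replicate, hf.card_z, hf.card_omega, omegaProd, Multiset.map_add,
      Multiset.prod_add, Multiset.map_map]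
    ring
  · intro f hf
    have hf : IsChainFreeProd n n₁ k₁ 0 k₃ k₄ I₁ I₃ f := hf
    have h0 : f.2.1 = 0 := Multiset.card_eq_zero.mp hf.card_y
    have hmem : ∀ z ∈ f.2.2.1 + f.1.map (fun a => (n + 1, a)),
        z ∈ idxI n n₁ f ∧ z.1 ≤ n + 1 ∧ z.2 ≤ n₁ := by
      intro z hz
      rcases Multiset.mem_add.mp hz with hz | hz
      · have := hf.z_mem z hz
        exact ⟨z_mem_idxI hz, by omega, this.2.2⟩
      · obtain ⟨a, ha, rfl⟩ := Multiset.mem_map.mp hz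
        exact ⟨x_mem_idxI ha, le_rfl, (hf.x_mem a ha).2⟩
    refine ⟨?_, ?_, hf.card_omega, ?_, fun w hw => (hf.omega_mem w hw).2.1, ?_, ?_, ?_⟩
    · rw [← hf.idx3_eq, idx3, h0, ← hf.card_x]
      simp [Multiset.map_map]
    · rw [← hf.idx1_eq, idx1]
      simp only [Multiset.map_add, Multiset.map_map, Function.comp_def, Multiset.map_id']
      abel
    · exact fun h => hf.not_has3Chain (h.mono fun z hz => (hmem z hz).1)
    · intro w hw z hz
      by_contra! h
      have h1 := hmem z hz
      have h3 := hf.omega_mem w hw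
      exact hf.not_hasOmega2Chain ⟨z, h1.1, _, omega_mem_idxI hw, by dsimp only; omega, h,
        by dsimp only; omega⟩
    · intro w hw w' hw' h
      by_contra! h'
      have h3 := hf.omega_mem w hw
      have h4 := hf.omega_mem w' hw'
      exact hf.not_hasOmega2Chain ⟨_, omega_mem_idxI hw, _, omega_mem_idxI hw',
        by dsimp only; omega, h, by dsimp only; omega⟩
    · intro w hw z hz z' hz' hfst hsnd
      by_contra! h
      have h1 := hmem z hz
      have h1' := hmem z' hz'
      have h3 := hf.omega_mem w hw
      have hle : w.2 ≤ z.2 := by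
        by_contra! h
        exact hf.not_hasOmega2Chain ⟨z, h1.1, _, omega_mem_idxI hw, by dsimp only; omega, h,
          by dsimp only; omega⟩
      exact hf.not_hasOmega3Chain ⟨z, h1.1, z', h1'.1, _, omega_mem_idxI hw, hle, hsnd, hfst,
        h1'.2.1, by dsimp only; omega, by dsimp only; omega⟩
  · have key : ∀ f, IsChainFreeProd n n₁ k₁ 0 k₃ k₄ I₁ I₃ f →
        f.1 = ((f.2.2.1 + f.1.map fun a => (n + 1, a)).filter
          (fun z => z.1 = n + 1)).map Prod.snd ∧
        f.2.2.1 = (f.2.2.1 + f.1.map fun a => (n + 1, a)).filter (fun z => z.1 ≠ n + 1) := by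
      intro f hf
      have hx : ∀ z ∈ f.1.map (fun a => (n + 1, a)), z.1 = n + 1 := by
        intro z hz
        obtain ⟨a, -, rfl⟩ := Multiset.mem_map.mp hz
        rfl
      have hz : ∀ z ∈ f.2.2.1, z.1 ≠ n + 1 := by
        intro z hz
        have := hf.z_mem z hz
        omega
      rw [Multiset.filter_add, Multiset.filter_add, Multiset.filter_eq_self.mpr hx,
        Multiset.filter_eq_self.mpr hz, Multiset.filter_eq_nil.mpr hz,
        Multiset.filter_eq_nil.mpr fun z h => not_not.mpr (hx z h), zero_add, add_zero,
        Multiset.map_map]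
      simp only [Function.comp_def, Multiset.map_id', and_self]
    intro f hf f' hf' hff
    have hff := Prod.ext_iff.mp hff
    have hy : ∀ f, IsChainFreeProd n n₁ k₁ 0 k₃ k₄ I₁ I₃ f → f.2.1 = 0 :=
      fun f hf => Multiset.card_eq_zero.mp hf.card_y
    refine Prod.ext ?_ (Prod.ext ((hy f hf).trans (hy f' hf').symm) (Prod.ext ?_ hff.2))
    · rw [(key f hf).1, (key f' hf').1]
      exact congrArg (fun S => (S.filter (fun z : ℕ × ℕ => z.1 = n + 1)).map Prod.snd) hff.1
    · rw [(key f hf).2, (key f' hf').2]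
      exact congrArg (fun S => S.filter (fun z : ℕ × ℕ => z.1 ≠ n + 1)) hff.1
  · intro j hj
    rcases Multiset.mem_add.mp hj with hj | hj
    · have := hI₃ j hj
      omega
    · have := Multiset.eq_of_mem_replicate hj
      omega

/-- Lemma 4.7 of the paper: with the numbers of factors of each kind and the index
multisets `ℐ₁`, `ℐ₃` fixed, the images under `φ̃` of the formal products whose index
multiset contains no 3-chain, no ω-2-chain and no ω-3-chain form a linearly independent
family in `A`. -/
theorem phiTilde_linearIndependent {F : Type*} [Field F] [CharZero F] (n n₁ : ℕ)
    (h1 : 1 ≤ n₁) (h2 : n₁ < n) (k₁ k₂ k₃ k₄ : ℕ) (I₁ I₃ : Multiset ℕ)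
    (hI₁card : Multiset.card I₁ = k₁ + k₃ + 2 * k₄)
    (hI₁ : ∀ a ∈ I₁, 1 ≤ a ∧ a ≤ n₁)
    (hI₃card : Multiset.card I₃ = k₂ + k₃)
    (hI₃ : ∀ b ∈ I₃, n₁ + 1 ≤ b ∧ b ≤ n) :
    LinearIndependent F (fun f : {f : FormalProd //
        Multiset.card f.1 = k₁ ∧ Multiset.card f.2.1 = k₂ ∧
        Multiset.card f.2.2.1 = k₃ ∧ Multiset.card f.2.2.2 = k₄ ∧
        (∀ a ∈ f.1, 1 ≤ a ∧ a ≤ n₁) ∧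
        (∀ b ∈ f.2.1, n₁ + 1 ≤ b ∧ b ≤ n) ∧
        (∀ z ∈ f.2.2.1, (n₁ + 1 ≤ z.1 ∧ z.1 ≤ n) ∧ (1 ≤ z.2 ∧ z.2 ≤ n₁)) ∧
        (∀ w ∈ f.2.2.2, 1 ≤ w.2 ∧ w.2 < w.1 ∧ w.1 ≤ n₁) ∧
        idx1 f = I₁ ∧ idx3 f = I₃ ∧
        ¬ Has3Chain (idxI n n₁ f) ∧
        ¬ HasOmega2Chain n (idxI n n₁ f) ∧
        ¬ HasOmega3Chain n n₁ (idxI n n₁ f)} =>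
      phiTilde F f.val) := by
  suffices h : LinearIndepOn F (phiTilde F) {f | IsChainFreeProd n n₁ k₁ k₂ k₃ k₄ I₁ I₃ f} by
    refine h.linearIndependent_subtype fun f hf => ?_
    obtain ⟨c₁, c₂, c₃, c₄, hx, hy, hz, hw, i₁, i₃, t₁, t₂, t₃⟩ := hf
    exact ⟨c₁, c₂, c₃, c₄, hx, hy, hz, hw, i₁, i₃, t₁, t₂, t₃⟩
  rcases Nat.eq_zero_or_pos k₄ with rfl | hk₄
  · exact linearIndepOn_phiTilde_of_omega_eq_zero F h2 k₁ k₂ k₃ hI₁ hI₃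
  rcases Nat.eq_zero_or_pos k₂ with rfl | hk₂
  · exact linearIndepOn_phiTilde_of_y_eq_zero F h2 k₁ k₃ k₄ hI₁ hI₃
  · refine (linearIndepOn_empty F _).mono fun f hf => ?_
    have hf : IsChainFreeProd n n₁ k₁ k₂ k₃ k₄ I₁ I₃ f := hf
    obtain ⟨b, hb⟩ := Multiset.card_pos_iff_exists_mem.mp (hf.card_y.symm ▸ hk₂)
    obtain ⟨w, hw⟩ := Multiset.card_pos_iff_exists_mem.mp (hf.card_omega.symm ▸ hk₄)
    have hb' := hf.y_mem b hb
    have hw' := hf.omega_mem w hw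
    exact hf.not_hasOmega2Chain ⟨_, y_mem_idxI hb, _, omega_mem_idxI hw, by dsimp only; omega,
      by dsimp only; omega, by dsimp only; omega⟩
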